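/- Let ω be a positive superharmonic function on the open unit disk 𝔻 and let T : 𝒟_ω → hol(𝔻) be a ℂ-linear map (not assumed continuous) such that (Tg)(z) ≠ 0 for every g ∈ 𝒟_ω that vanishes nowhere on 𝔻 and every z ∈ 𝔻. Then there exist holomorphic functions φ : 𝔻 → 𝔻 and ψ : 𝔻 → ℂ∖{0} such that Tf = ψ·(f∘φ) for all f ∈ 𝒟_ω. -/

import Mathlib

open MeasureTheory

noncomputable section

/-- The open unit disk in `ℂ`. -/
def unitDisk : Set ℂ := Metric.ball 0 1

/-- A function on the unit disk is holomorphic if it extends to a function on `ℂ`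
that is holomorphic on the disk. -/
def HolOn (f : unitDisk → ℂ) : Prop :=
  ∃ F : ℂ → ℂ, DifferentiableOn ℂ F unitDisk ∧ ∀ z : unitDisk, f z = F z

/-- `ω : ℂ → ℝ` is superharmonic on the unit disk: lower semicontinuous there, and
satisfying the super-mean-value inequality
`(1/2π) ∫₀^{2π} ω(z₀ + r e^{iθ}) dθ ≤ ω z₀` whenever the closed disk of centre `z₀`
and radius `r > 0` is contained in the unit disk.  (The circle integral of the
positive function `ω` is taken as a lower Lebesgue integral.) -/
def SuperharmonicOn (ω : ℂ → ℝ) : Prop :=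
  LowerSemicontinuousOn ω unitDisk ∧
  ∀ (z₀ : ℂ) (r : ℝ), 0 < r → Metric.closedBall z₀ r ⊆ unitDisk →
    (∫⁻ θ in Set.Ioc (0 : ℝ) (2 * Real.pi),
        ENNReal.ofReal (ω (z₀ + (r : ℂ) * Complex.exp ((θ : ℂ) * Complex.I))))
      ≤ ENNReal.ofReal (2 * Real.pi * ω z₀)

/-- Membership in the weighted Dirichlet space `𝒟_ω`: `f` is holomorphic on the unit
disk and `∫_𝔻 |f′(z)|² ω(z) dA(z) < ∞`. -/
def dirichletMem (ω : ℂ → ℝ) (f : unitDisk → ℂ) : Prop :=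
  ∃ F : ℂ → ℂ, DifferentiableOn ℂ F unitDisk ∧ (∀ z : unitDisk, f z = F z) ∧
    (∫⁻ z in unitDisk, ENNReal.ofReal (‖deriv F z‖ ^ 2 * ω z)) < ⊤

/-- Newton's identity for the second elementary symmetric function. -/
theorem Multiset.two_mul_esymm_two {R : Type*} [CommRing R] (s : Multiset R) :
    2 * s.esymm 2 = s.sum ^ 2 - (s.map (· ^ 2)).sum := by
  induction s using Multiset.induction with
  | empty => simp [Multiset.esymm, Multiset.powersetCard_zero_right]
  | cons a s ih =>
    have h : (a ::ₘ s).esymm 2 = s.esymm 2 + a * s.sum := by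
      simpa [Multiset.esymm, Multiset.powersetCard_cons, Multiset.powersetCard_one] using
        Multiset.sum_map_mul_left (s := s) (f := id) (a := a)
    rw [h, mul_add, ih]
    simp only [Multiset.sum_cons, Multiset.map_cons]
    ring

theorem Multiset.esymm_one_eq_sum {R : Type*} [CommRing R] (s : Multiset R) :
    s.esymm 1 = s.sum := by
  simp [Multiset.esymm, Multiset.powersetCard_one]

/-- The power sum of order two of the roots of a monic polynomial, bounded by the size of the
roots. -/
theorem Polynomial.norm_coeff_sq_sub_le {p : Polynomial ℂ} (hp : p.Monic) {n : ℕ}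
    (hn : p.natDegree = n + 2) {R : ℝ} (hR : ∀ x, p.eval x = 0 → ‖x‖ ≤ R) :
    ‖p.coeff (n + 1) ^ 2 - 2 * p.coeff n‖ ≤ (n + 2) * R ^ 2 := by
  have hcard : p.roots.card = p.natDegree :=
    (Polynomial.splits_iff_card_roots.1 (IsAlgClosed.splits p))
  have h1 := Polynomial.coeff_eq_esymm_roots_of_card hcard (k := n + 1) (by omega)
  have h2 := Polynomial.coeff_eq_esymm_roots_of_card hcard (k := n) (by omega)
  have e1 : n + 2 - (n + 1) = 1 := by omega
  have e2 : n + 2 - n = 2 := by omega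
  rw [hn, hp.leadingCoeff] at h1 h2
  rw [e1, Multiset.esymm_one_eq_sum] at h1
  rw [e2] at h2
  have h3 : p.coeff (n + 1) ^ 2 - 2 * p.coeff n = (p.roots.map (· ^ 2)).sum := by
    have := Multiset.two_mul_esymm_two p.roots
    rw [h1, h2]
    linear_combination -this
  have hs : ∀ s : Multiset ℂ, (∀ x ∈ s, ‖x‖ ≤ R) →
      ‖(s.map (· ^ 2)).sum‖ ≤ s.card * R ^ 2 := by
    intro s
    induction s using Multiset.induction with
    | empty => simp
    | cons a s ih =>
      intro h
      have ha := h a (Multiset.mem_cons_self a s)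
      have hs := ih fun x hx => h x (Multiset.mem_cons_of_mem hx)
      simp only [Multiset.map_cons, Multiset.sum_cons, Multiset.card_cons]
      calc _ ≤ ‖a ^ 2‖ + _ := norm_add_le _ _
        _ ≤ R ^ 2 + s.card * R ^ 2 := by
          rw [norm_pow]
          gcongr
        _ = _ := by push_cast; ring
  rw [h3]
  refine (hs _ fun x hx => hR x ?_).trans_eq ?_
  · exact (Polynomial.mem_roots'.1 hx).2
  · rw [hcard, hn]; push_cast; ring

/-- A linear functional on a commutative complex algebra which does not vanish on powers of
`λ - a` for large `λ` is multiplicative (the algebraic core of the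
Gleason–Kahane–Żelazko theorem). -/
theorem LinearMap.map_mul_of_pow_ne_zero {A : Type*} [CommRing A] [Algebra ℂ A] (L : A →ₗ[ℂ] ℂ)
    (h1 : L 1 = 1)
    (h : ∀ a : A, ∃ R : ℝ, ∀ x : ℂ, R < ‖x‖ → ∀ n : ℕ, L ((algebraMap ℂ A x - a) ^ n) ≠ 0)
    (a b : A) : L (a * b) = L a * L b := by
  have sq : ∀ a : A, L (a ^ 2) = L a ^ 2 := by
    intro a
    obtain ⟨R, hR⟩ := h (-a)
    have key : ∀ n : ℕ,
        ‖((n + 2 : ℂ) * L a) ^ 2 - (n + 2) * (n + 1) * L (a ^ 2)‖ ≤ (n + 2) * R ^ 2 := by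
      intro n
      let p : Polynomial ℂ := ∑ k ∈ Finset.range (n + 3),
        Polynomial.C (((n + 2).choose k : ℂ) * L (a ^ (n + 2 - k))) * Polynomial.X ^ k
      have hcoeff : ∀ k < n + 3, p.coeff k = ((n + 2).choose k : ℂ) * L (a ^ (n + 2 - k)) := by
        intro k hk
        simp only [p, Polynomial.finsetSum_coeff, Polynomial.coeff_C_mul_X_pow]
        rw [Finset.sum_ite_eq, if_pos (Finset.mem_range.2 hk)]
      have hdeg : p.natDegree ≤ n + 2 := by
        refine Polynomial.natDegree_sum_le_of_forall_le _ _ fun k hk => ?_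
        exact (Polynomial.natDegree_C_mul_X_pow_le _ _).trans (by
          have := Finset.mem_range.1 hk; omega)
      have htop : p.coeff (n + 2) = 1 := by
        rw [hcoeff _ (by omega)]; simp [h1]
      have hmonic : p.Monic := Polynomial.monic_of_natDegree_le_of_coeff_eq_one _ hdeg htop
      have hnat : p.natDegree = n + 2 :=
        le_antisymm hdeg (Polynomial.le_natDegree_of_ne_zero (by rw [htop]; exact one_ne_zero))
      have heval : ∀ x : ℂ, p.eval x = L ((algebraMap ℂ A x - -a) ^ (n + 2)) := by
        intro x
        rw [sub_neg_eq_add, add_pow, map_sum]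
        simp only [p, Polynomial.eval_finsetSum, Polynomial.eval_mul, Polynomial.eval_C,
          Polynomial.eval_pow, Polynomial.eval_X]
        refine Finset.sum_congr rfl fun k _ => ?_
        have : algebraMap ℂ A x ^ k * a ^ (n + 2 - k) * ((n + 2).choose k : A)
            = (x ^ k * ((n + 2).choose k : ℂ)) • a ^ (n + 2 - k) := by
          rw [Algebra.smul_def, map_mul, map_pow, map_natCast]; ring
        rw [this, map_smul, smul_eq_mul]
        ring
      have := Polynomial.norm_coeff_sq_sub_le hmonic hnat (R := R) fun x hx => by
        by_contra hlt
        exact hR x (not_le.1 hlt) (n + 2) ((heval x).symm.trans hx)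
      rw [hcoeff _ (by omega), hcoeff _ (by omega)] at this
      have e1 : n + 2 - (n + 1) = 1 := by omega
      have e2 : n + 2 - n = 2 := by omega
      have c1 : ((n + 2).choose (n + 1) : ℂ) = n + 2 := by
        rw [Nat.choose_succ_self_right]; push_cast; ring
      have c2 : 2 * ((n + 2).choose n : ℂ) = (n + 2) * (n + 1) := by
        have : (n + 2).choose n = (n + 2).choose 2 := by
          rw [← Nat.choose_symm (by omega : 2 ≤ n + 2)]; simp
        rw [this, Nat.cast_choose_two]; push_cast; ring
      rw [e1, e2, pow_one, c1, ← mul_assoc, c2] at this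
      exact this
    have key2 : ∀ n : ℕ, (n + 1 : ℝ) * ‖L a ^ 2 - L (a ^ 2)‖ ≤ R ^ 2 + ‖L a ^ 2‖ := by
      intro n
      have h3 := key n
      have : ((n + 2 : ℂ) * L a) ^ 2 - (n + 2) * (n + 1) * L (a ^ 2)
          = (n + 2 : ℂ) * ((n + 1) * (L a ^ 2 - L (a ^ 2)) + L a ^ 2) := by ring
      have hn : ‖(n + 2 : ℂ)‖ = n + 2 := by
        have : (n + 2 : ℂ) = ((n + 2 : ℕ) : ℂ) := by push_cast; rfl
        rw [this, Complex.norm_natCast]; push_cast; rfl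
      have hn1 : ‖(n + 1 : ℂ)‖ = n + 1 := by
        have : (n + 1 : ℂ) = ((n + 1 : ℕ) : ℂ) := by push_cast; rfl
        rw [this, Complex.norm_natCast]; push_cast; rfl
      rw [this, norm_mul, hn] at h3
      have h4 := le_of_mul_le_mul_left h3 (by positivity)
      have h5 := norm_sub_norm_le ((n + 1 : ℂ) * (L a ^ 2 - L (a ^ 2))) (-(L a ^ 2))
      rw [sub_neg_eq_add, norm_neg, norm_mul, hn1] at h5
      linarith
    have h0 : ‖L a ^ 2 - L (a ^ 2)‖ = 0 := by
      by_contra hne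
      have hpos : 0 < ‖L a ^ 2 - L (a ^ 2)‖ := lt_of_le_of_ne (norm_nonneg _) (Ne.symm hne)
      obtain ⟨n, hn⟩ := exists_nat_gt ((R ^ 2 + ‖L a ^ 2‖) / ‖L a ^ 2 - L (a ^ 2)‖)
      rw [div_lt_iff₀ hpos] at hn
      have := key2 n
      nlinarith
    exact (sub_eq_zero.1 (norm_eq_zero.1 h0)).symm
  have h2 := sq (a + b)
  have : (a + b) ^ 2 = a ^ 2 + b ^ 2 + (a * b + a * b) := by ring
  rw [this, map_add, map_add, map_add, map_add, sq, sq] at h2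
  have : (2 : ℂ) * L (a * b) = 2 * (L a * L b) := by linear_combination h2
  exact mul_left_cancel₀ two_ne_zero this

theorem isOpen_unitDisk : IsOpen unitDisk := Metric.isOpen_ball

theorem measurableSet_unitDisk : MeasurableSet unitDisk := isOpen_unitDisk.measurableSet

theorem mem_unitDisk {z : ℂ} : z ∈ unitDisk ↔ ‖z‖ < 1 := by
  simp [unitDisk]

theorem DifferentiableOn.differentiableAt_of_mem_unitDisk {F : ℂ → ℂ}
    (hF : DifferentiableOn ℂ F unitDisk) {z : ℂ} (hz : z ∈ unitDisk) : DifferentiableAt ℂ F z :=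
  hF.differentiableAt (isOpen_unitDisk.mem_nhds hz)

/-- The `W`-weighted Dirichlet energy of `F` on a set `S`, without normalization. -/
def dirichletEnergy (W : ℂ → ENNReal) (F : ℂ → ℂ) (S : Set ℂ) : ENNReal :=
  ∫⁻ z in S, W z * ENNReal.ofReal (‖deriv F z‖ ^ 2)

/-- Holomorphic functions on the unit disk with finite `W`-weighted Dirichlet energy. -/
structure IsDirichlet (W : ℂ → ENNReal) (F : ℂ → ℂ) : Prop where
  differentiableOn : DifferentiableOn ℂ F unitDisk
  energy_lt_top : dirichletEnergy W F unitDisk < ⊤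

namespace IsDirichlet

variable {W : ℂ → ENNReal} {F G H : ℂ → ℂ}

theorem of_norm_deriv_le (hW : Measurable W) (hWi : ∫⁻ z in unitDisk, W z < ⊤)
    (hF : IsDirichlet W F) (hG : IsDirichlet W G) (hH : DifferentiableOn ℂ H unitDisk) {C : ℝ}
    (h : ∀ z ∈ unitDisk, ‖deriv H z‖ ≤ C * (1 + ‖deriv F z‖ + ‖deriv G z‖)) :
    IsDirichlet W H := by
  refine ⟨hH, ?_⟩
  have hb : ∀ z ∈ unitDisk, W z * ENNReal.ofReal (‖deriv H z‖ ^ 2) ≤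
      ENNReal.ofReal (3 * C ^ 2) * (W z + W z * ENNReal.ofReal (‖deriv F z‖ ^ 2)
        + W z * ENNReal.ofReal (‖deriv G z‖ ^ 2)) := by
    intro z hz
    have h1 : ‖deriv H z‖ ^ 2 ≤ 3 * C ^ 2 * (1 + ‖deriv F z‖ ^ 2 + ‖deriv G z‖ ^ 2) := by
      have h2 : ‖deriv H z‖ ^ 2 ≤ (C * (1 + ‖deriv F z‖ + ‖deriv G z‖)) ^ 2 :=
        pow_le_pow_left₀ (norm_nonneg _) (h z hz) 2
      refine h2.trans ?_
      rw [mul_pow, mul_comm (3 : ℝ), mul_assoc]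
      refine mul_le_mul_of_nonneg_left ?_ (sq_nonneg C)
      nlinarith [sq_nonneg (1 - ‖deriv F z‖), sq_nonneg (1 - ‖deriv G z‖),
        sq_nonneg (‖deriv F z‖ - ‖deriv G z‖)]
    calc W z * ENNReal.ofReal (‖deriv H z‖ ^ 2)
        ≤ W z * ENNReal.ofReal (3 * C ^ 2 * (1 + ‖deriv F z‖ ^ 2 + ‖deriv G z‖ ^ 2)) := by
          gcongr
      _ = _ := by
          rw [ENNReal.ofReal_mul (by positivity), ENNReal.ofReal_add (by positivity) (by positivity),
            ENNReal.ofReal_add (by positivity) (by positivity), ENNReal.ofReal_one]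
          ring
  refine (setLIntegral_mono' measurableSet_unitDisk hb).trans_lt ?_
  rw [lintegral_const_mul' _ _ ENNReal.ofReal_ne_top]
  refine ENNReal.mul_lt_top ENNReal.ofReal_lt_top ?_
  have m : ∀ K : ℂ → ℂ, Measurable fun z => W z * ENNReal.ofReal (‖deriv K z‖ ^ 2) := fun K =>
    hW.mul ((measurable_deriv K).norm.pow_const 2).ennreal_ofReal
  rw [lintegral_add_right _ (m G), lintegral_add_right _ (m F)]
  exact ENNReal.add_lt_top.2 ⟨ENNReal.add_lt_top.2 ⟨hWi, hF.2⟩, hG.2⟩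

theorem congr (hF : IsDirichlet W F) (h : Set.EqOn F G unitDisk) : IsDirichlet W G := by
  refine ⟨hF.1.congr fun z hz => (h hz).symm, ?_⟩
  refine lt_of_eq_of_lt ?_ hF.2
  refine setLIntegral_congr_fun measurableSet_unitDisk fun z hz => ?_
  have : deriv G z = deriv F z :=
    (Filter.EventuallyEq.deriv_eq (Filter.eventuallyEq_of_mem (isOpen_unitDisk.mem_nhds hz) h)).symm
  simp only [this]

theorem const (c : ℂ) : IsDirichlet W fun _ => c :=
  ⟨differentiableOn_const c, by simp [dirichletEnergy]⟩

theorem id (hWi : ∫⁻ z in unitDisk, W z < ⊤) : IsDirichlet W fun z => z :=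
  ⟨differentiableOn_id, by simpa [dirichletEnergy] using hWi⟩

theorem add (hW : Measurable W) (hWi : ∫⁻ z in unitDisk, W z < ⊤)
    (hF : IsDirichlet W F) (hG : IsDirichlet W G) : IsDirichlet W (F + G) := by
  refine of_norm_deriv_le (C := 1) hW hWi hF hG (hF.1.add hG.1) fun z hz => ?_
  rw [deriv_add (hF.1.differentiableAt_of_mem_unitDisk hz)
    (hG.1.differentiableAt_of_mem_unitDisk hz)]
  linarith [norm_add_le (deriv F z) (deriv G z)]

theorem const_smul (hW : Measurable W) (hWi : ∫⁻ z in unitDisk, W z < ⊤)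
    (c : ℂ) (hF : IsDirichlet W F) : IsDirichlet W (c • F) := by
  refine of_norm_deriv_le (C := ‖c‖) hW hWi hF hF (hF.1.const_smul c) fun z hz => ?_
  rw [deriv_const_smul _ (hF.1.differentiableAt_of_mem_unitDisk hz), norm_smul]
  gcongr
  linarith [norm_nonneg (deriv F z)]

theorem mul (hW : Measurable W) (hWi : ∫⁻ z in unitDisk, W z < ⊤)
    (hF : IsDirichlet W F) (hG : IsDirichlet W G) {A : ℝ}
    (hFA : ∀ z ∈ unitDisk, ‖F z‖ ≤ A) (hGA : ∀ z ∈ unitDisk, ‖G z‖ ≤ A) :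
    IsDirichlet W (F * G) := by
  refine of_norm_deriv_le (C := A) hW hWi hF hG (hF.1.mul hG.1) fun z hz => ?_
  rw [deriv_mul (hF.1.differentiableAt_of_mem_unitDisk hz)
    (hG.1.differentiableAt_of_mem_unitDisk hz)]
  refine (norm_add_le _ _).trans ?_
  rw [norm_mul, norm_mul]
  nlinarith [hFA z hz, hGA z hz, norm_nonneg (F z), norm_nonneg (deriv F z),
    norm_nonneg (deriv G z), mul_le_mul_of_nonneg_left (hGA z hz) (norm_nonneg (deriv F z)),
    mul_le_mul_of_nonneg_right (hFA z hz) (norm_nonneg (deriv G z))]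

/-- Dividing out a zero of a bounded function of finite Dirichlet energy. -/
theorem exists_eq_add_sub_mul (hW : Measurable W) (hWi : ∫⁻ z in unitDisk, W z < ⊤)
    (hF : IsDirichlet W F) {A : ℝ} (hFA : ∀ z ∈ unitDisk, ‖F z‖ ≤ A) {w : ℂ} (hw : w ∈ unitDisk) :
    ∃ G : ℂ → ℂ, IsDirichlet W G ∧ (∃ B : ℝ, ∀ z ∈ unitDisk, ‖G z‖ ≤ B) ∧
      ∀ z, F z = F w + (z - w) * G z := by
  have hnhds := isOpen_unitDisk.mem_nhds hw
  have hd : DifferentiableOn ℂ (dslope F w) unitDisk :=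
    (Complex.differentiableOn_dslope hnhds).2 hF.1
  obtain ⟨r, hr, hrD⟩ := Metric.nhds_basis_closedBall.mem_iff.1 hnhds
  have hdd : ContinuousOn (deriv (dslope F w)) unitDisk :=
    (hd.deriv isOpen_unitDisk).continuousOn
  obtain ⟨B₁, hB₁⟩ := (isCompact_closedBall w r).exists_bound_of_continuousOn
    (hd.continuousOn.mono hrD)
  obtain ⟨B₂, hB₂⟩ := (isCompact_closedBall w r).exists_bound_of_continuousOn (hdd.mono hrD)
  have hA : 0 ≤ A := (norm_nonneg _).trans (hFA w hw)
  have hB₁0 : 0 ≤ B₁ := (norm_nonneg _).trans (hB₁ w (Metric.mem_closedBall_self hr.le))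
  have hB₂0 : 0 ≤ B₂ := (norm_nonneg _).trans (hB₂ w (Metric.mem_closedBall_self hr.le))
  have heq : ∀ z, F z = F w + (z - w) * dslope F w z := by
    intro z
    have := sub_smul_dslope F w z
    rw [smul_eq_mul] at this
    rw [this]; ring
  have hbound : ∀ z ∈ unitDisk, ‖dslope F w z‖ ≤ B₁ + 2 * A / r := by
    intro z hz
    by_cases hzr : z ∈ Metric.closedBall w r
    · exact (hB₁ z hzr).trans (le_add_of_nonneg_right (by positivity))
    · rw [Metric.mem_closedBall, not_le, dist_eq_norm] at hzr
      have h1 : ‖z - w‖ * ‖dslope F w z‖ ≤ 2 * A := by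
        rw [← norm_mul]
        have : (z - w) * dslope F w z = F z - F w := by rw [heq z]; ring
        rw [this]
        linarith [norm_sub_le (F z) (F w), hFA z hz, hFA w hw]
      have h2 : ‖dslope F w z‖ ≤ 2 * A / r := by
        rw [le_div_iff₀ hr]
        nlinarith [norm_nonneg (dslope F w z)]
      linarith
  refine ⟨dslope F w, ?_, ⟨_, hbound⟩, heq⟩
  refine of_norm_deriv_le (C := B₂ + (B₁ + 2 * A / r + 1) / r) hW hWi hF hF hd fun z hz => ?_
  have hCr : 0 ≤ (B₁ + 2 * A / r + 1) / r := by positivity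
  by_cases hzr : z ∈ Metric.closedBall w r
  · have := hB₂ z hzr
    nlinarith [norm_nonneg (deriv F z), mul_nonneg hB₂0 (norm_nonneg (deriv F z)),
      mul_nonneg hCr (norm_nonneg (deriv F z))]
  · rw [Metric.mem_closedBall, not_le, dist_eq_norm] at hzr
    have hdz := hd.differentiableAt_of_mem_unitDisk hz
    have hder : deriv F z = dslope F w z + (z - w) * deriv (dslope F w) z := by
      have h1 : HasDerivAt (fun z => F w + (z - w) * dslope F w z)
          (1 * dslope F w z + (z - w) * deriv (dslope F w) z) z :=
        (((hasDerivAt_id z).sub_const w).mul hdz.hasDerivAt).const_add _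
      rw [one_mul] at h1
      have h2 : F = fun z => F w + (z - w) * dslope F w z := funext heq
      conv_lhs => rw [h2]
      exact h1.deriv
    have h1 : ‖z - w‖ * ‖deriv (dslope F w) z‖ ≤ ‖deriv F z‖ + (B₁ + 2 * A / r) := by
      rw [← norm_mul]
      have : (z - w) * deriv (dslope F w) z = deriv F z - dslope F w z := by rw [hder]; ring
      rw [this]
      linarith [norm_sub_le (deriv F z) (dslope F w z), hbound z hz]
    have hK : 0 ≤ B₁ + 2 * A / r := by positivity
    have h2 : ‖deriv (dslope F w) z‖ ≤
        (B₁ + 2 * A / r + 1) / r * (1 + ‖deriv F z‖ + ‖deriv F z‖) := by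
      rw [div_mul_eq_mul_div, le_div_iff₀ hr]
      nlinarith [norm_nonneg (deriv (dslope F w) z), norm_nonneg (deriv F z),
        mul_nonneg hK (norm_nonneg (deriv F z))]
    nlinarith [mul_nonneg hB₂0 (norm_nonneg (deriv F z))]

end IsDirichlet

/-- The algebra of bounded functions of finite weighted Dirichlet energy. -/
def boundedDirichlet (W : ℂ → ENNReal) (hW : Measurable W) (hWi : ∫⁻ z in unitDisk, W z < ⊤) :
    Subalgebra ℂ (ℂ → ℂ) where
  carrier := {F | IsDirichlet W F ∧ ∃ A : ℝ, ∀ z ∈ unitDisk, ‖F z‖ ≤ A}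
  mul_mem' := by
    rintro F G ⟨hF, A, hA⟩ ⟨hG, B, hB⟩
    have hA' : ∀ z ∈ unitDisk, ‖F z‖ ≤ max A B := fun z hz => (hA z hz).trans (le_max_left _ _)
    have hB' : ∀ z ∈ unitDisk, ‖G z‖ ≤ max A B := fun z hz => (hB z hz).trans (le_max_right _ _)
    refine ⟨hF.mul hW hWi hG hA' hB', max A B * max A B, fun z hz => ?_⟩
    rw [Pi.mul_apply, norm_mul]
    exact mul_le_mul (hA' z hz) (hB' z hz) (norm_nonneg _) ((norm_nonneg _).trans (hA' z hz))
  add_mem' := by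
    rintro F G ⟨hF, A, hA⟩ ⟨hG, B, hB⟩
    exact ⟨hF.add hW hWi hG, A + B, fun z hz =>
      (norm_add_le _ _).trans (add_le_add (hA z hz) (hB z hz))⟩
  algebraMap_mem' := fun c => ⟨IsDirichlet.const c, ‖c‖, fun _ _ => le_rfl⟩

/-- A functional on a weighted Dirichlet space which is linear, normalized, and does not vanish on
nowhere-vanishing functions. -/
structure IsNonvanishingFunctional (W : ℂ → ENNReal) (L : (ℂ → ℂ) → ℂ) : Prop where
  map_add : ∀ F G, IsDirichlet W F → IsDirichlet W G → L (F + G) = L F + L G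
  map_smul : ∀ (c : ℂ) (F), IsDirichlet W F → L (c • F) = c * L F
  map_one : L 1 = 1
  ne_zero : ∀ F, IsDirichlet W F → (∀ z ∈ unitDisk, F z ≠ 0) → L F ≠ 0

namespace IsNonvanishingFunctional

variable {W : ℂ → ENNReal} {L : (ℂ → ℂ) → ℂ}

theorem map_const (hL : IsNonvanishingFunctional W L) (c : ℂ) : L (fun _ => c) = c := by
  have : (fun _ : ℂ => c) = c • (1 : ℂ → ℂ) := by ext; simp
  rw [this, hL.map_smul c 1 (IsDirichlet.const 1), hL.map_one, mul_one]

theorem map_mem_unitDisk (hL : IsNonvanishingFunctional W L) (hW : Measurable W)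
    (hWi : ∫⁻ z in unitDisk, W z < ⊤) : L (fun z => z) ∈ unitDisk := by
  rw [mem_unitDisk]
  by_contra h
  set w := L (fun z => z)
  have hid : IsDirichlet W fun z => z := IsDirichlet.id hWi
  refine hL.ne_zero ((fun z => z) + fun _ => -w) (hid.add hW hWi (IsDirichlet.const _)) ?_ ?_
  · intro z hz h0
    rw [mem_unitDisk] at hz
    have : z = w := by simpa [add_neg_eq_zero] using h0
    rw [this] at hz
    exact h hz
  · rw [hL.map_add _ _ hid (IsDirichlet.const _), hL.map_const]
    exact add_neg_cancel w

theorem map_mul (hL : IsNonvanishingFunctional W L) (hW : Measurable W)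
    (hWi : ∫⁻ z in unitDisk, W z < ⊤) {F G : ℂ → ℂ} (hF : F ∈ boundedDirichlet W hW hWi)
    (hG : G ∈ boundedDirichlet W hW hWi) : L (F * G) = L F * L G := by
  let M : boundedDirichlet W hW hWi →ₗ[ℂ] ℂ :=
    { toFun := fun F => L F
      map_add' := fun F G => hL.map_add F G F.2.1 G.2.1
      map_smul' := fun c F => hL.map_smul c F F.2.1 }
  refine M.map_mul_of_pow_ne_zero hL.map_one ?_ ⟨F, hF⟩ ⟨G, hG⟩
  rintro ⟨K, hK⟩
  obtain ⟨A, hA⟩ := hK.2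
  refine ⟨A, fun x hx n => ?_⟩
  refine hL.ne_zero _ (Subtype.property (p := fun F => F ∈ boundedDirichlet W hW hWi) _).1 ?_
  intro z hz h0
  have h1 : (x - K z) ^ n = 0 := h0
  have h2 := sub_eq_zero.1 (eq_zero_of_pow_eq_zero h1)
  exact absurd (hA z hz) (by rw [← h2]; exact not_le.2 hx)

theorem map_eq_of_bounded (hL : IsNonvanishingFunctional W L) (hW : Measurable W)
    (hWi : ∫⁻ z in unitDisk, W z < ⊤) {F : ℂ → ℂ} (hF : IsDirichlet W F) {A : ℝ}
    (hA : ∀ z ∈ unitDisk, ‖F z‖ ≤ A) : L F = F (L fun z => z) := by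
  set w := L fun z => z
  have hw : w ∈ unitDisk := hL.map_mem_unitDisk hW hWi
  obtain ⟨G, hG, ⟨B, hB⟩, hFG⟩ := hF.exists_eq_add_sub_mul hW hWi hA hw
  have hid : IsDirichlet W fun z => z := IsDirichlet.id hWi
  have hS : ((fun z => z) + fun _ => -w) ∈ boundedDirichlet W hW hWi := by
    refine ⟨hid.add hW hWi (IsDirichlet.const _), 1 + ‖w‖, fun z hz => ?_⟩
    rw [mem_unitDisk] at hz
    refine (norm_add_le _ _).trans ?_
    rw [norm_neg]
    gcongr
  have hG' : G ∈ boundedDirichlet W hW hWi := ⟨hG, B, hB⟩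
  have h1 : F = (fun _ => F w) + ((fun z => z) + fun _ => -w) * G := by
    ext z
    rw [hFG z]
    simp [sub_eq_add_neg]
  have h2 : L ((fun z => z) + fun _ => -w) = 0 := by
    rw [hL.map_add _ _ hid (IsDirichlet.const _), hL.map_const]
    exact add_neg_cancel w
  conv_lhs => rw [h1]
  rw [hL.map_add _ _ (IsDirichlet.const _) (mul_mem hS hG').1, hL.map_const,
    hL.map_mul hW hWi hS hG', h2, zero_mul, add_zero]

theorem map_eq_of_one_le_re (hL : IsNonvanishingFunctional W L) (hW : Measurable W)
    (hWi : ∫⁻ z in unitDisk, W z < ⊤) {F : ℂ → ℂ} (hF : IsDirichlet W F)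
    (hre : ∀ z ∈ unitDisk, 1 ≤ (F z).re) : L F = F (L fun z => z) := by
  set w := L fun z => z with hwdef
  have hw : w ∈ unitDisk := hL.map_mem_unitDisk hW hWi
  by_contra hne
  have hF1 : ∀ z ∈ unitDisk, 1 ≤ ‖F z‖ := fun z hz =>
    (hre z hz).trans (Complex.re_le_norm _)
  have hF0 : ∀ z ∈ unitDisk, F z ≠ 0 := fun z hz h0 => by
    have := hF1 z hz
    rw [h0, norm_zero] at this
    linarith
  have ht : (F w - L F) / F w ≠ 0 := div_ne_zero (sub_ne_zero.2 (Ne.symm hne)) (hF0 w hw)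
  set a := F w * Complex.log ((F w - L F) / F w) with ha
  let K : ℂ → ℂ := fun z => F z * Complex.exp (a / F z)
  have hdF := hF.1
  have hKd : DifferentiableOn ℂ K unitDisk := by
    refine hdF.mul (DifferentiableOn.cexp ?_)
    exact (differentiableOn_const a).div hdF hF0
  have hq : ∀ z ∈ unitDisk, ‖a / F z‖ ≤ ‖a‖ := fun z hz => by
    rw [norm_div]
    exact div_le_self (norm_nonneg _) (hF1 z hz)
  have hK : IsDirichlet W K := by
    refine IsDirichlet.of_norm_deriv_le (C := Real.exp ‖a‖ * (1 + ‖a‖)) hW hWi hF hF hKd ?_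
    intro z hz
    have hz0 := hF0 z hz
    have hdz := (hdF.differentiableAt_of_mem_unitDisk hz).hasDerivAt
    have h1 : HasDerivAt K (deriv F z * Complex.exp (a / F z)
        + F z * (Complex.exp (a / F z) * ((0 * F z - a * deriv F z) / F z ^ 2))) z :=
      hdz.mul (((hasDerivAt_const z a).div hdz hz0).cexp)
    have h2 : deriv K z = Complex.exp (a / F z) * (1 - a / F z) * deriv F z := by
      rw [h1.deriv]
      field_simp
      ring
    rw [h2, norm_mul, norm_mul]
    have h3 : ‖Complex.exp (a / F z)‖ ≤ Real.exp ‖a‖ := by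
      rw [Complex.norm_exp]
      exact Real.exp_le_exp.2 ((Complex.re_le_norm _).trans (hq z hz))
    have h4 : ‖1 - a / F z‖ ≤ 1 + ‖a‖ := by
      refine (norm_sub_le _ _).trans ?_
      rw [norm_one]
      linarith [hq z hz]
    have h5 : ‖deriv F z‖ ≤ 1 + ‖deriv F z‖ + ‖deriv F z‖ := by
      linarith [norm_nonneg (deriv F z)]
    gcongr
  let g : ℂ → ℂ := K + (-1 : ℂ) • F
  have hFneg : IsDirichlet W ((-1 : ℂ) • F) := hF.const_smul hW hWi (-1)
  have hg : IsDirichlet W g := hK.add hW hWi hFneg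
  have hgb : ∀ z ∈ unitDisk, ‖g z‖ ≤ ‖a‖ * Real.exp ‖a‖ := by
    intro z hz
    have hz0 := hF0 z hz
    have h1 : g z = F z * (Complex.exp (a / F z) - 1) := by
      simp only [g, K, Pi.add_apply, Pi.smul_apply, smul_eq_mul]
      ring
    have h2 := Complex.norm_exp_sub_sum_le_norm_mul_exp (a / F z) 1
    simp only [Finset.range_one, Finset.sum_singleton, pow_zero, Nat.factorial_zero,
      Nat.cast_one, div_one, pow_one] at h2
    rw [h1, norm_mul]
    calc ‖F z‖ * ‖Complex.exp (a / F z) - 1‖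
        ≤ ‖F z‖ * (‖a / F z‖ * Real.exp ‖a / F z‖) := by gcongr
      _ = ‖a‖ * Real.exp ‖a / F z‖ := by
          rw [norm_div]
          have : ‖F z‖ ≠ 0 := norm_ne_zero_iff.2 hz0
          field_simp
      _ ≤ _ := by
          gcongr
          exact hq z hz
  have hgw := hL.map_eq_of_bounded hW hWi hg hgb
  rw [hL.map_add _ _ hK hFneg, hL.map_smul _ _ hF, ← hwdef] at hgw
  have hKw : K w = F w - L F := by
    have : a / F w = Complex.log ((F w - L F) / F w) := by
      rw [ha]
      exact mul_div_cancel_left₀ _ (hF0 w hw)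
    simp only [K, this, Complex.exp_log ht]
    exact mul_div_cancel₀ _ (hF0 w hw)
  have hL0 : L K = 0 := by
    have : g w = K w - F w := by simp [g, sub_eq_add_neg]
    rw [this, hKw] at hgw
    linear_combination hgw
  exact hL.ne_zero K hK (fun z hz => mul_ne_zero (hF0 z hz) (Complex.exp_ne_zero _)) hL0

/-- If real parts have majorants of finite energy, then a nonvanishing functional is an
evaluation. -/
theorem map_eq (hL : IsNonvanishingFunctional W L) (hW : Measurable W)
    (hWi : ∫⁻ z in unitDisk, W z < ⊤) {F H : ℂ → ℂ} (hF : IsDirichlet W F)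
    (hH : IsDirichlet W H) (h : ∀ z ∈ unitDisk, |(F z).re| ≤ (H z).re) :
    L F = F (L fun z => z) := by
  have h1 : IsDirichlet W (H + fun _ => 1) := hH.add hW hWi (IsDirichlet.const 1)
  have h2 : IsDirichlet W (F + (H + fun _ => 1)) := hF.add hW hWi h1
  have e1 := hL.map_eq_of_one_le_re hW hWi h1 fun z hz => by
    have := (abs_nonneg _).trans (h z hz)
    simpa using this
  have e2 := hL.map_eq_of_one_le_re hW hWi h2 fun z hz => by
    have := (abs_le.1 (h z hz)).1
    simp only [Pi.add_apply, Complex.add_re, Complex.one_re]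
    linarith
  rw [hL.map_add _ _ hF h1, e1, Pi.add_apply] at e2
  exact add_right_cancel e2

end IsNonvanishingFunctional

theorem ENNReal.ofReal_integral_le_lintegral_ofReal {α : Type*} [MeasurableSpace α]
    {μ : Measure α} {f : α → ℝ} (hf : Integrable f μ) :
    ENNReal.ofReal (∫ x, f x ∂μ) ≤ ∫⁻ x, ENNReal.ofReal (f x) ∂μ := by
  have h1 : ∫ x, f x ∂μ ≤ ∫ x, max (f x) 0 ∂μ :=
    integral_mono hf hf.pos_part fun x => le_max_left _ _
  refine (ENNReal.ofReal_le_ofReal h1).trans_eq ?_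
  rw [ofReal_integral_eq_lintegral_ofReal hf.pos_part (.of_forall fun x => le_max_right _ _)]
  refine lintegral_congr fun x => ?_
  rcases le_total (f x) 0 with h | h
  · rw [max_eq_right h, ENNReal.ofReal_of_nonpos h, ENNReal.ofReal_zero]
  · rw [max_eq_left h]

/-- The unnormalized lower integral of `G` over the circle `z + ρ e^{iθ}`. -/
def circleLIntegral (G : ℂ → ENNReal) (z : ℂ) (ρ : ℝ) : ENNReal :=
  ∫⁻ θ in Set.Ioc (0 : ℝ) (2 * Real.pi), G (circleMap z ρ θ)

theorem integrable_re_circleMap_and_integral_eq {Q : ℂ → ℂ} {U : Set ℂ}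
    (hQ : DifferentiableOn ℂ Q U) {z : ℂ} {ρ : ℝ} (hzU : Metric.closedBall z |ρ| ⊆ U) :
    Integrable (fun θ => (Q (circleMap z ρ θ)).re)
        (volume.restrict (Set.Ioc (0 : ℝ) (2 * Real.pi))) ∧
      ∫ θ in Set.Ioc (0 : ℝ) (2 * Real.pi), (Q (circleMap z ρ θ)).re = 2 * Real.pi * (Q z).re := by
  have hcont : ContinuousOn Q (Metric.sphere z |ρ|) :=
    hQ.continuousOn.mono (Metric.sphere_subset_closedBall.trans hzU)
  have hci : CircleIntegrable Q z ρ := hcont.circleIntegrable'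
  have hmean : Real.circleAverage Q z ρ = Q z := by
    refine DiffContOnCl.circleAverage ?_
    exact ⟨hQ.mono (Metric.ball_subset_closedBall.trans hzU),
      hQ.continuousOn.mono (Metric.closure_ball_subset_closedBall.trans hzU)⟩
  refine ⟨((intervalIntegrable_iff_integrableOn_Ioc_of_le Real.two_pi_pos.le).1 hci).re, ?_⟩
  have h1 := Complex.reCLM.circleAverage_comp_comm hci
  rw [hmean, Real.circleAverage_def, intervalIntegral.integral_of_le Real.two_pi_pos.le,
    smul_eq_mul] at h1
  have h2 : (Complex.reCLM (Q z)) = (Q z).re := rfl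
  rw [← h2, ← h1, mul_inv_cancel_left₀ Real.two_pi_pos.ne']
  rfl

theorem ofReal_re_le_circleLIntegral {G : ℂ → ENNReal} {Q : ℂ → ℂ} {U : Set ℂ}
    (hQ : DifferentiableOn ℂ Q U) {z : ℂ} {ρ : ℝ} (hzU : Metric.closedBall z |ρ| ⊆ U)
    (hG : ∀ x ∈ Metric.sphere z |ρ|, ENNReal.ofReal (Q x).re ≤ G x) :
    ENNReal.ofReal (2 * Real.pi * (Q z).re) ≤ circleLIntegral G z ρ := by
  obtain ⟨hint, hre⟩ := integrable_re_circleMap_and_integral_eq hQ hzU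
  rw [← hre]
  refine (ENNReal.ofReal_integral_le_lintegral_ofReal hint).trans ?_
  exact lintegral_mono fun θ => hG _ (circleMap_mem_sphere' z ρ θ)

/-- A quantitative super-mean-value property on the unit disk. -/
def IsSuperMean (W : ℂ → ENNReal) (κ : ENNReal) : Prop :=
  ∀ (z : ℂ) (ρ : ℝ), 0 < ρ → Metric.closedBall z ρ ⊆ unitDisk →
    circleLIntegral W z ρ + κ * ENNReal.ofReal (2 * Real.pi * ρ ^ 2)
      ≤ ENNReal.ofReal (2 * Real.pi) * W z

theorem circleMap_neg_radius_add (z : ℂ) (ρ θ : ℝ) :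
    circleMap (z + (ρ : ℂ) * Complex.exp (θ * Complex.I)) (-ρ) θ = z := by
  simp [circleMap]

/-- The super-mean-value property tested against a nonnegative function. -/
theorem IsSuperMean.lintegral_mul_circleLIntegral_le {W : ℂ → ENNReal} {κ : ENNReal}
    (hS : IsSuperMean W κ) (hW : Measurable W) {g : ℂ → ENNReal} (hg : Measurable g) {ρ : ℝ}
    (hρ : 0 < ρ) (hsupp : ∀ z, g z ≠ 0 → Metric.closedBall z ρ ⊆ unitDisk) :
    (∫⁻ z, W z * circleLIntegral g z (-ρ))
        + κ * ENNReal.ofReal (2 * Real.pi * ρ ^ 2) * ∫⁻ z, g z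
      ≤ ENNReal.ofReal (2 * Real.pi) * ∫⁻ z, W z * g z := by
  have hm1 : Measurable fun p : ℂ × ℝ => W p.1 * g (circleMap p.1 (-ρ) p.2) := by
    refine (hW.comp measurable_fst).mul (hg.comp ?_)
    unfold circleMap
    fun_prop
  have hm2 : Measurable fun p : ℂ × ℝ => W (circleMap p.1 ρ p.2) * g p.1 := by
    refine (hW.comp ?_).mul (hg.comp measurable_fst)
    unfold circleMap
    fun_prop
  have hswap : (∫⁻ z, W z * circleLIntegral g z (-ρ)) = ∫⁻ z, circleLIntegral W z ρ * g z := by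
    calc (∫⁻ z, W z * circleLIntegral g z (-ρ))
        = ∫⁻ z, ∫⁻ θ in Set.Ioc (0 : ℝ) (2 * Real.pi), W z * g (circleMap z (-ρ) θ) := by
          refine lintegral_congr fun z => ?_
          rw [circleLIntegral, lintegral_const_mul]
          refine hg.comp ?_
          unfold circleMap
          fun_prop
      _ = ∫⁻ θ in Set.Ioc (0 : ℝ) (2 * Real.pi), ∫⁻ z, W z * g (circleMap z (-ρ) θ) :=
          lintegral_lintegral_swap hm1.aemeasurable
      _ = ∫⁻ θ in Set.Ioc (0 : ℝ) (2 * Real.pi), ∫⁻ z, W (circleMap z ρ θ) * g z := by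
          refine lintegral_congr fun θ => ?_
          rw [← lintegral_add_right_eq_self (fun z => W z * g (circleMap z (-ρ) θ))
            ((ρ : ℂ) * Complex.exp (θ * Complex.I))]
          refine lintegral_congr fun z => ?_
          rw [circleMap_neg_radius_add]
          rfl
      _ = ∫⁻ z, ∫⁻ θ in Set.Ioc (0 : ℝ) (2 * Real.pi), W (circleMap z ρ θ) * g z :=
          (lintegral_lintegral_swap hm2.aemeasurable).symm
      _ = _ := by
          refine lintegral_congr fun z => ?_
          rw [circleLIntegral, lintegral_mul_const]
          refine hW.comp ?_
          unfold circleMap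
          fun_prop
  rw [hswap, ← lintegral_const_mul _ hg, ← lintegral_add_right _ (hg.const_mul _),
    ← lintegral_const_mul (f := fun z => W z * g z) _ (hW.mul hg)]
  refine lintegral_mono fun z => ?_
  by_cases h0 : g z = 0
  · simp [h0]
  · have := hS z ρ hρ (hsupp z h0)
    calc _ = (circleLIntegral W z ρ + κ * ENNReal.ofReal (2 * Real.pi * ρ ^ 2)) * g z := by
          rw [add_mul]
      _ ≤ ENNReal.ofReal (2 * Real.pi) * W z * g z := by gcongr
      _ = _ := by rw [mul_assoc]

/-- The function to which the super-mean-value property is applied: it controls the energy of `H`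
by that of `f` wherever it is positive. -/
def energyTest (H f : ℂ → ℂ) (z : ℂ) : ℝ := (H z).re ^ 2 - (f z).re ^ 2 + 1 - ‖z‖ ^ 2

theorem sq_norm_ge_re (a b c : ℂ) : 2 * (star (a + b) * c).re - ‖a + b‖ ^ 2 ≤ ‖c‖ ^ 2 := by
  rw [← Complex.normSq_eq_norm_sq, ← Complex.normSq_eq_norm_sq, Complex.normSq_apply,
    Complex.normSq_apply]
  simp only [Complex.star_def, Complex.mul_re, Complex.conj_re, Complex.conj_im]
  nlinarith [sq_nonneg ((a + b).re - c.re), sq_nonneg ((a + b).im - c.im)]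

/-- A holomorphic minorant of `energyTest H f` on a circle, with a good real part at the centre. -/
theorem exists_energyTest_minorant {H f : ℂ → ℂ} {U : Set ℂ} (hU : IsOpen U)
    (hH : DifferentiableOn ℂ H U) (hf : DifferentiableOn ℂ f U) {z : ℂ} (hz : z ∈ U) {ρ η : ℝ}
    (hη : ∀ x ∈ Metric.sphere z ρ, ‖f x - f z‖ ≤ (‖deriv f z‖ + η) * ρ) :
    ∃ Q : ℂ → ℂ, DifferentiableOn ℂ Q U ∧
      (∀ x ∈ Metric.sphere z ρ, (Q x).re ≤ energyTest H f x) ∧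
      (Q z).re = energyTest H f z
        + ρ ^ 2 * (‖deriv H z‖ ^ 2 / 2 - (‖deriv f z‖ + η) ^ 2 / 2 - 1) := by
  have hD : DifferentiableOn ℂ (dslope H z) U :=
    (Complex.differentiableOn_dslope (hU.mem_nhds hz)).2 hH
  set a := H z
  set b := deriv H z
  set c := f z
  set d := ‖deriv f z‖ + η
  let Q₁ : ℂ → ℂ := fun x => (1 / 2 : ℂ) * H x ^ 2 + star a * H x + (ρ : ℂ) ^ 2 * star b * dslope H z x
    - ((‖a‖ ^ 2 / 2 + ρ ^ 2 * ‖b‖ ^ 2 / 2 : ℝ) : ℂ)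
  let Q₂ : ℂ → ℂ := fun x => (1 / 2 : ℂ) * f x ^ 2 + star c * f x
    + ((ρ ^ 2 * d ^ 2 / 2 - ‖c‖ ^ 2 / 2 : ℝ) : ℂ)
  let Q₃ : ℂ → ℂ := fun x => 2 * star z * (x - z) + ((‖z‖ ^ 2 + ρ ^ 2 : ℝ) : ℂ)
  have hsq : ∀ u : ℂ, ((1 / 2 : ℂ) * u ^ 2).re = u.re ^ 2 - ‖u‖ ^ 2 / 2 := by
    intro u
    rw [← Complex.normSq_eq_norm_sq, Complex.normSq_apply, show (1 / 2 : ℂ) = ((1 / 2 : ℝ) : ℂ) by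
      push_cast; rfl, Complex.re_ofReal_mul, pow_two, Complex.mul_re]
    ring
  have hss : ∀ u : ℂ, (star u * u).re = ‖u‖ ^ 2 := by
    intro u
    rw [← Complex.normSq_eq_norm_sq, Complex.normSq_apply]
    simp [Complex.mul_re]
  refine ⟨fun x => Q₁ x - Q₂ x + 1 - Q₃ x, ?_, ?_, ?_⟩
  · simp only [Q₁, Q₂, Q₃]
    fun_prop
  · intro x hx
    have hxρ : ‖x - z‖ = ρ := by rwa [← dist_eq_norm]
    have h1 : (Q₁ x).re ≤ (H x).re ^ 2 := by
      have hHx : H x = a + (x - z) * dslope H z x := by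
        have := sub_smul_dslope H z x
        rw [smul_eq_mul] at this
        rw [this]; ring
      have h2 := sq_norm_ge_re a (b * (x - z)) (H x)
      have h3 : star (a + b * (x - z)) * H x = star a * H x + star (b * (x - z)) * a
          + (ρ : ℂ) ^ 2 * star b * dslope H z x := by
        have hv : star (x - z) * (x - z) = (ρ : ℂ) ^ 2 := by
          rw [Complex.star_def, mul_comm, Complex.mul_conj, Complex.normSq_eq_norm_sq, hxρ]
          push_cast; rfl
        rw [star_add, add_mul, add_assoc, ← hv]
        congr 1
        conv_lhs => rw [hHx]
        rw [star_mul]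
        ring
      have h4 : ‖a + b * (x - z)‖ ^ 2 = ‖a‖ ^ 2 + 2 * (star (b * (x - z)) * a).re
          + ρ ^ 2 * ‖b‖ ^ 2 := by
        have : ρ ^ 2 * ‖b‖ ^ 2 = ‖b * (x - z)‖ ^ 2 := by rw [norm_mul, hxρ]; ring
        rw [this]
        simp only [← Complex.normSq_eq_norm_sq, Complex.normSq_apply, Complex.star_def,
          Complex.mul_re (starRingEnd ℂ _), Complex.conj_re, Complex.conj_im, Complex.add_re,
          Complex.add_im]
        ring
      rw [h3, h4] at h2
      simp only [Complex.add_re] at h2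
      simp only [Q₁, Complex.sub_re, Complex.add_re, hsq, Complex.ofReal_re]
      linarith
    have h2 : (f x).re ^ 2 ≤ (Q₂ x).re := by
      have h3 : ‖f x - c‖ ^ 2 ≤ (d * ρ) ^ 2 := pow_le_pow_left₀ (norm_nonneg _) (hη x hx) 2
      have h4 : ‖f x - c‖ ^ 2 = ‖f x‖ ^ 2 - 2 * (star c * f x).re + ‖c‖ ^ 2 := by
        simp only [← Complex.normSq_eq_norm_sq, Complex.normSq_apply, Complex.star_def,
          Complex.mul_re, Complex.conj_re, Complex.conj_im, Complex.sub_re, Complex.sub_im]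
        ring
      simp only [Q₂, Complex.add_re, hsq, Complex.ofReal_re]
      rw [h4] at h3
      nlinarith
    have h3 : ‖x‖ ^ 2 = (Q₃ x).re := by
      have h4 : ‖x - z‖ ^ 2 = ‖x‖ ^ 2 - 2 * (star z * (x - z)).re - ‖z‖ ^ 2 := by
        simp only [← Complex.normSq_eq_norm_sq, Complex.normSq_apply, Complex.star_def,
          Complex.mul_re, Complex.conj_re, Complex.conj_im, Complex.sub_re, Complex.sub_im]
        ring
      rw [hxρ] at h4
      simp only [Q₃, Complex.add_re, Complex.ofReal_re, mul_assoc]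
      rw [show (2 : ℂ) = ((2 : ℝ) : ℂ) by push_cast; rfl, Complex.re_ofReal_mul]
      linarith
    simp only [energyTest, Complex.sub_re, Complex.add_re, Complex.one_re]
    linarith
  · have hb : ((ρ : ℂ) ^ 2 * star b * b).re = ρ ^ 2 * ‖b‖ ^ 2 := by
      rw [mul_assoc, ← Complex.ofReal_pow, Complex.re_ofReal_mul, hss]
    simp only [Q₁, Q₂, Q₃, energyTest, Complex.sub_re, Complex.add_re, Complex.one_re, hsq,
      Complex.ofReal_re, dslope_same, sub_self, mul_zero, Complex.zero_re]
    have e1 : H z = a := rfl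
    have e2 : f z = c := rfl
    have e3 : deriv H z = b := rfl
    rw [e1, e2, e3, hss, hss, hb]
    ring

/-- A radius on which the increments of `f` are controlled by its derivative at the centre. -/
theorem exists_pos_norm_sub_le {f : ℂ → ℂ} {U K : Set ℂ} (hU : IsOpen U)
    (hf : DifferentiableOn ℂ f U) (hK : IsCompact K) (hKU : K ⊆ U) :
    ∃ δ > 0, ∀ ρ : ℝ, 0 < ρ → ρ < δ → ∀ z, Metric.closedBall z ρ ⊆ K →
      ∀ x ∈ Metric.sphere z ρ, ‖f x - f z‖ ≤ (‖deriv f z‖ + 1) * ρ := by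
  have hc : ContinuousOn (deriv f) K := (hf.deriv hU).continuousOn.mono hKU
  obtain ⟨δ, hδ, h⟩ := Metric.uniformContinuousOn_iff.1 (hK.uniformContinuousOn_of_continuous hc)
    1 one_pos
  refine ⟨δ, hδ, fun ρ hρ hρδ z hz x hx => ?_⟩
  have hzK : z ∈ K := hz (Metric.mem_closedBall_self hρ.le)
  have hxρ : ‖x - z‖ = ρ := by rwa [← dist_eq_norm]
  rw [← hxρ]
  refine Convex.norm_image_sub_le_of_norm_deriv_le (s := Metric.closedBall z ρ)
    (fun y hy => hf.differentiableAt (hU.mem_nhds (hKU (hz hy)))) (fun y hy => ?_)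
    (convex_closedBall z ρ) (Metric.mem_closedBall_self hρ.le) (Metric.sphere_subset_closedBall hx)
  have h1 : dist (deriv f y) (deriv f z) < 1 := h y (hz hy) z hzK (lt_of_le_of_lt hy hρδ)
  rw [dist_eq_norm] at h1
  linarith [norm_sub_norm_le (deriv f y) (deriv f z)]

theorem continuousOn_energyTest {H f : ℂ → ℂ} {U : Set ℂ} (hH : ContinuousOn H U)
    (hf : ContinuousOn f U) : ContinuousOn (energyTest H f) U := by
  have h1 : ContinuousOn (fun z => (H z).re) U := Complex.continuous_re.comp_continuousOn hH
  have h2 : ContinuousOn (fun z => (f z).re) U := Complex.continuous_re.comp_continuousOn hf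
  unfold energyTest
  fun_prop

/-- The superlevel set on which the energy of `H` is controlled by that of `f`. -/
def energySet (H f : ℂ → ℂ) (r ε : ℝ) : Set ℂ :=
  {z | z ∈ Metric.ball (0 : ℂ) r ∧ ε < energyTest H f z}

theorem energySet_subset_ball {H f : ℂ → ℂ} {r ε : ℝ} : energySet H f r ε ⊆ Metric.ball 0 r :=
  fun _ hz => hz.1

theorem closedBall_zero_subset_unitDisk {r : ℝ} (hr : r < 1) :
    Metric.closedBall (0 : ℂ) r ⊆ unitDisk := Metric.closedBall_subset_ball hr

theorem measurableSet_energySet {H f : ℂ → ℂ} (hH : DifferentiableOn ℂ H unitDisk)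
    (hf : DifferentiableOn ℂ f unitDisk) {r ε : ℝ} (hr : r < 1) :
    MeasurableSet (energySet H f r ε) := by
  have hc := continuousOn_energyTest hH.continuousOn hf.continuousOn
  have := (hc.mono (Metric.ball_subset_closedBall.trans
    (closedBall_zero_subset_unitDisk hr))).isOpen_inter_preimage Metric.isOpen_ball
    (isOpen_Ioi (a := ε))
  exact this.measurableSet

theorem IsSuperMean.energy_energySet_le {W : ℂ → ENNReal} (hS : IsSuperMean W 1)
    (hW : Measurable W) (hWi : ∫⁻ z in unitDisk, W z < ⊤) {H f : ℂ → ℂ}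
    (hH : DifferentiableOn ℂ H unitDisk) (hf : DifferentiableOn ℂ f unitDisk) {r ε : ℝ}
    (hr : r < 1) (hbd : ∀ z ∈ Metric.sphere (0 : ℂ) r, energyTest H f z < ε) :
    dirichletEnergy W H (energySet H f r ε)
        + 2 * ∫⁻ z in energySet H f r ε, ENNReal.ofReal (energyTest H f z - ε)
      ≤ ∫⁻ z in unitDisk, W z * ENNReal.ofReal (2 * ‖deriv f z‖ ^ 2 + 4) := by
  set S := energySet H f r ε with hSdef
  have hSm : MeasurableSet S := measurableSet_energySet hH hf hr
  have hrD : Metric.closedBall (0 : ℂ) r ⊆ unitDisk := closedBall_zero_subset_unitDisk hr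
  have hc : ContinuousOn (energyTest H f) (Metric.closedBall 0 r) :=
    (continuousOn_energyTest hH.continuousOn hf.continuousOn).mono hrD
  have hSD : S ⊆ unitDisk := fun z hz => hrD (Metric.ball_subset_closedBall hz.1)
  -- the superlevel set stays away from the boundary circle
  obtain ⟨s, hsr, hs⟩ : ∃ s < r, ∀ z ∈ S, ‖z‖ ≤ s := by
    have hKc : IsCompact (Metric.closedBall (0 : ℂ) r ∩ energyTest H f ⁻¹' Set.Ici ε) :=
      (isCompact_closedBall _ _).of_isClosed_subset
        (hc.preimage_isClosed_of_isClosed Metric.isClosed_closedBall isClosed_Ici)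
        Set.inter_subset_left
    rcases (Metric.closedBall (0 : ℂ) r ∩ energyTest H f ⁻¹' Set.Ici ε).eq_empty_or_nonempty
      with he | hne
    · refine ⟨r - 1, by linarith, fun z hz => ?_⟩
      have : z ∈ (∅ : Set ℂ) := he ▸ ⟨Metric.ball_subset_closedBall hz.1, hz.2.le⟩
      exact this.elim
    · obtain ⟨y, hy, hmax⟩ := hKc.exists_isMaxOn hne continuous_norm.continuousOn
      refine ⟨‖y‖, ?_, fun z hz => hmax ⟨Metric.ball_subset_closedBall hz.1, hz.2.le⟩⟩
      have hyr : ‖y‖ ≤ r := by simpa using hy.1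
      refine lt_of_le_of_ne hyr fun h => ?_
      have := hbd y (by simpa using h)
      exact absurd hy.2 (not_le.2 this)
  obtain ⟨δ, hδ, hδf⟩ := exists_pos_norm_sub_le isOpen_unitDisk hf
    (isCompact_closedBall (0 : ℂ) r) hrD
  obtain ⟨ρ, hρ, hρm⟩ := exists_between (lt_min hδ (sub_pos.2 hsr))
  have hρδ : ρ < δ := hρm.trans_le (min_le_left _ _)
  have hρs : ρ < r - s := hρm.trans_le (min_le_right _ _)
  have hball : ∀ z ∈ S, Metric.closedBall z ρ ⊆ Metric.ball 0 r := fun z hz =>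
    Metric.closedBall_subset_ball' (by rw [dist_zero_right]; linarith [hs z hz])
  set g : ℂ → ENNReal := S.indicator fun z => ENNReal.ofReal (energyTest H f z - ε) with hg
  have hgm : Measurable g := by
    have hcs : ContinuousOn (energyTest H f) S :=
      hc.mono (energySet_subset_ball.trans Metric.ball_subset_closedBall)
    classical
    rw [hg, ← Set.piecewise_eq_indicator]
    exact ContinuousOn.measurable_piecewise (ENNReal.continuous_ofReal.comp_continuousOn
      (hcs.sub continuousOn_const)) continuousOn_const hSm
  have hgS : ∀ z, g z ≠ 0 → z ∈ S := fun z hz => Set.mem_of_indicator_ne_zero hz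
  have hgle : ∀ z ∈ Metric.ball (0 : ℂ) r, ENNReal.ofReal (energyTest H f z - ε) ≤ g z := by
    intro z hz
    by_cases h : z ∈ S
    · rw [hg, Set.indicator_of_mem h]
    · have : energyTest H f z ≤ ε := by
        by_contra! h'
        exact h ⟨hz, h'⟩
      rw [ENNReal.ofReal_of_nonpos (by linarith)]
      exact zero_le
  -- pointwise lower bound for the circular means of `g`
  have hpt : ∀ z ∈ S, W z * (ENNReal.ofReal (2 * Real.pi) * g z)
      + W z * ENNReal.ofReal (Real.pi * ρ ^ 2 * ‖deriv H z‖ ^ 2)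
      ≤ W z * circleLIntegral g z (-ρ)
        + W z * ENNReal.ofReal (Real.pi * ρ ^ 2 * (2 * ‖deriv f z‖ ^ 2 + 4)) := by
    intro z hz
    obtain ⟨Q, hQ, hQs, hQz⟩ := exists_energyTest_minorant isOpen_unitDisk hH hf (hSD hz)
      (hδf ρ hρ hρδ z ((hball z hz).trans Metric.ball_subset_closedBall))
    have h1 : ENNReal.ofReal (2 * Real.pi * (Q z - ε).re) ≤ circleLIntegral g z (-ρ) := by
      refine ofReal_re_le_circleLIntegral (Q := fun x => Q x - ε) (U := unitDisk)
        (hQ.sub_const _) ?_ ?_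
      · rw [abs_neg, abs_of_pos hρ]
        exact (hball z hz).trans (Metric.ball_subset_closedBall.trans hrD)
      · rw [abs_neg, abs_of_pos hρ]
        intro x hx
        refine le_trans (ENNReal.ofReal_le_ofReal ?_)
          (hgle x (hball z hz (Metric.sphere_subset_closedBall hx)))
        simpa using hQs x hx
    rw [← mul_add, ← mul_add]
    refine mul_le_mul_right ?_ _
    refine le_trans ?_ (add_le_add h1 le_rfl)
    rw [hg, Set.indicator_of_mem hz, ← ENNReal.ofReal_mul (by positivity),
      ← ENNReal.ofReal_add (mul_nonneg (by positivity) (sub_nonneg.2 hz.2.le)) (by positivity)]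
    refine le_trans (ENNReal.ofReal_le_ofReal ?_) ENNReal.ofReal_add_le
    rw [Complex.sub_re, hQz, Complex.ofReal_re]
    have h2 : 0 ≤ Real.pi * ρ ^ 2 := by positivity
    nlinarith [mul_nonneg h2 (sq_nonneg (‖deriv f z‖ - 1))]
  have hmain := hS.lintegral_mul_circleLIntegral_le hW hgm hρ fun z hz =>
    (hball z (hgS z hz)).trans (Metric.ball_subset_closedBall.trans hrD)
  rw [one_mul] at hmain
  have hWg : ∫⁻ z, W z * g z = ∫⁻ z in S, W z * g z := by
    rw [← lintegral_indicator hSm]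
    refine lintegral_congr fun z => ?_
    by_cases h : z ∈ S
    · rw [Set.indicator_of_mem h]
    · rw [Set.indicator_of_notMem h, hg, Set.indicator_of_notMem h, mul_zero]
  have hfin : ∫⁻ z, W z * g z ≠ ⊤ := by
    obtain ⟨B, hB⟩ := (isCompact_closedBall (0 : ℂ) r).exists_bound_of_continuousOn hc
    refine ne_top_of_le_ne_top (b := ENNReal.ofReal (B - ε) * ∫⁻ z in unitDisk, W z)
      (ENNReal.mul_ne_top ENNReal.ofReal_ne_top hWi.ne) ?_
    rw [hWg, ← lintegral_const_mul _ hW]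
    refine (setLIntegral_mono' hSm fun z hz => ?_).trans (lintegral_mono_set hSD)
    rw [hg, Set.indicator_of_mem hz, mul_comm]
    gcongr
    exact (le_abs_self _).trans (hB z (Metric.ball_subset_closedBall hz.1))
  have hint := setLIntegral_mono' (μ := volume) hSm hpt
  have hgint : ∫⁻ z, g z = ∫⁻ z in S, ENNReal.ofReal (energyTest H f z - ε) :=
    lintegral_indicator hSm _
  have hmH : Measurable fun z => W z * ENNReal.ofReal (Real.pi * ρ ^ 2 * ‖deriv H z‖ ^ 2) :=
    hW.mul (((measurable_deriv H).norm.pow_const 2).const_mul _).ennreal_ofReal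
  have hmf : Measurable fun z =>
      W z * ENNReal.ofReal (Real.pi * ρ ^ 2 * (2 * ‖deriv f z‖ ^ 2 + 4)) :=
    hW.mul (((((measurable_deriv f).norm.pow_const 2).const_mul _).add_const _).const_mul
      _).ennreal_ofReal
  have hρ2 : 0 < Real.pi * ρ ^ 2 := by positivity
  have hpull : ∀ (u : ℂ → ℝ), Measurable u →
      ∫⁻ z in S, W z * ENNReal.ofReal (Real.pi * ρ ^ 2 * u z)
        = ENNReal.ofReal (Real.pi * ρ ^ 2) * ∫⁻ z in S, W z * ENNReal.ofReal (u z) := by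
    intro u hu
    rw [← lintegral_const_mul (f := fun z => W z * ENNReal.ofReal (u z)) _
      (hW.mul hu.ennreal_ofReal)]
    refine lintegral_congr fun z => ?_
    rw [ENNReal.ofReal_mul hρ2.le]
    ring
  rw [lintegral_add_right _ hmH, lintegral_add_right _ hmf, hpull _
    ((measurable_deriv H).norm.pow_const 2), hpull _
    ((((measurable_deriv f).norm.pow_const 2).const_mul _).add_const _)] at hint
  have hWg' : ∫⁻ z in S, W z * (ENNReal.ofReal (2 * Real.pi) * g z)
      = ENNReal.ofReal (2 * Real.pi) * ∫⁻ z, W z * g z := by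
    rw [hWg, ← lintegral_const_mul (f := fun z => W z * g z) _ (hW.mul hgm)]
    refine lintegral_congr fun z => ?_
    ring
  rw [hWg'] at hint
  have hrestr : ∫⁻ z in S, W z * circleLIntegral g z (-ρ) ≤ ∫⁻ z, W z * circleLIntegral g z (-ρ) :=
    setLIntegral_le_lintegral _ _
  rw [hgint, show 2 * Real.pi * ρ ^ 2 = Real.pi * ρ ^ 2 * 2 by ring, ENNReal.ofReal_mul hρ2.le]
    at hmain
  have hSle := lintegral_mono_set (μ := volume)
    (f := fun z => W z * ENNReal.ofReal (2 * ‖deriv f z‖ ^ 2 + 4)) hSD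
  refine le_trans ?_ hSle
  unfold dirichletEnergy
  have hp0 : ENNReal.ofReal (Real.pi * ρ ^ 2) ≠ 0 := by simpa using hρ2
  refine (ENNReal.mul_le_mul_iff_right hp0 ENNReal.ofReal_ne_top).1 ?_
  refine (ENNReal.add_le_add_iff_left
    (ENNReal.mul_ne_top (ENNReal.ofReal_ne_top (r := 2 * Real.pi)) hfin)).1 ?_
  rw [ENNReal.ofReal_ofNat, mul_assoc] at hmain
  calc _ = (ENNReal.ofReal (2 * Real.pi) * ∫⁻ z, W z * g z) + ENNReal.ofReal (Real.pi * ρ ^ 2)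
          * (∫⁻ z in S, W z * ENNReal.ofReal (‖deriv H z‖ ^ 2))
        + ENNReal.ofReal (Real.pi * ρ ^ 2)
          * (2 * ∫⁻ z in S, ENNReal.ofReal (energyTest H f z - ε)) := by ring
    _ ≤ _ := add_le_add (hint.trans (add_le_add hrestr le_rfl)) le_rfl
    _ = _ := add_right_comm _ _ _
    _ ≤ _ := add_le_add hmain le_rfl

theorem exists_polynomial_of_mem_span_fourier {T r : ℝ} (hr : r ≠ 0)
    {p : C(AddCircle T, ℂ)} (hp : p ∈ Submodule.span ℂ (Set.range (@fourier T))) :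
    ∃ P Q : Polynomial ℂ, ∀ t, p t = P.eval ((r : ℂ) * AddCircle.toCircle t)
      + starRingEnd ℂ (Q.eval ((r : ℂ) * AddCircle.toCircle t)) := by
  have hr' : (r : ℂ) ≠ 0 := Complex.ofReal_ne_zero.2 hr
  have hmono : ∀ (n : ℕ) (t : AddCircle T), fourier n t
      = (Polynomial.C ((r : ℂ) ^ n)⁻¹ * Polynomial.X ^ n : Polynomial ℂ).eval
        ((r : ℂ) * AddCircle.toCircle t) := by
    intro n t
    rw [Polynomial.eval_mul, Polynomial.eval_C, Polynomial.eval_pow, Polynomial.eval_X, mul_pow,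
      inv_mul_cancel_left₀ (pow_ne_zero n hr'), fourier_apply, AddCircle.toCircle_zsmul,
      zpow_natCast, Circle.coe_pow]
  induction hp using Submodule.span_induction with
  | mem p hp =>
    obtain ⟨n, rfl⟩ := hp
    obtain ⟨n, rfl | rfl⟩ := n.eq_nat_or_neg
    · exact ⟨Polynomial.C ((r : ℂ) ^ n)⁻¹ * Polynomial.X ^ n, 0, fun t => by
        rw [Polynomial.eval_zero, map_zero, add_zero]; exact hmono n t⟩
    · exact ⟨0, Polynomial.C ((r : ℂ) ^ n)⁻¹ * Polynomial.X ^ n, fun t => by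
        rw [fourier_neg, Polynomial.eval_zero, zero_add]; exact congrArg _ (hmono n t)⟩
  | zero => exact ⟨0, 0, fun t => by simp⟩
  | add p q _ _ hp hq =>
    obtain ⟨P, Q, h⟩ := hp
    obtain ⟨P', Q', h'⟩ := hq
    refine ⟨P + P', Q + Q', fun t => ?_⟩
    rw [ContinuousMap.add_apply, h, h', Polynomial.eval_add, Polynomial.eval_add, map_add]
    ring
  | smul c p _ hp =>
    obtain ⟨P, Q, h⟩ := hp
    refine ⟨Polynomial.C c * P, Polynomial.C (starRingEnd ℂ c) * Q, fun t => ?_⟩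
    rw [ContinuousMap.smul_apply, h, Polynomial.eval_mul, Polynomial.eval_mul, Polynomial.eval_C,
      Polynomial.eval_C, map_mul, Complex.conj_conj, smul_eq_mul]
    ring

/-- Continuous real functions on a circle are uniform limits of real parts of polynomials. -/
theorem exists_polynomial_re_near {r : ℝ} (hr : 0 < r) {v : ℂ → ℝ}
    (hv : ContinuousOn v (Metric.sphere 0 r)) {δ : ℝ} (hδ : 0 < δ) :
    ∃ P : Polynomial ℂ, (P.eval 0).im = 0 ∧
      ∀ z ∈ Metric.sphere (0 : ℂ) r, |(P.eval z).re - v z| < δ := by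
  have : Fact (0 < 2 * Real.pi) := ⟨Real.two_pi_pos⟩
  have hcirc : ∀ t : AddCircle (2 * Real.pi),
      (r : ℂ) * AddCircle.toCircle t ∈ Metric.sphere (0 : ℂ) r := fun t => by
    rw [mem_sphere_zero_iff_norm, norm_mul, Circle.norm_coe, Complex.norm_real,
      Real.norm_of_nonneg hr.le, mul_one]
  let g : C(AddCircle (2 * Real.pi), ℂ) :=
    ⟨fun t => (v ((r : ℂ) * AddCircle.toCircle t) : ℂ), Complex.continuous_ofReal.comp
      (hv.comp_continuous (continuous_const.mul
        (continuous_subtype_val.comp AddCircle.continuous_toCircle)) hcirc)⟩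
  have hg : g ∈ (Submodule.span ℂ (Set.range (@fourier (2 * Real.pi)))).topologicalClosure := by
    rw [span_fourier_closure_eq_top]
    trivial
  obtain ⟨p, hp, hpg⟩ := Metric.mem_closure_iff.1 hg δ hδ
  obtain ⟨P, Q, h⟩ := exists_polynomial_of_mem_span_fourier hr.ne' hp
  refine ⟨P + Q - Polynomial.C ((((P + Q).eval 0).im : ℂ) * Complex.I), by simp, fun z hz => ?_⟩
  have hz' : ‖z‖ = r := by simpa using hz
  obtain ⟨t, ht⟩ : ∃ t : AddCircle (2 * Real.pi), (r : ℂ) * AddCircle.toCircle t = z := by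
    have hw : ‖z / r‖ = 1 := by
      rw [norm_div, hz', Complex.norm_real, Real.norm_of_nonneg hr.le, div_self hr.ne']
    obtain ⟨t, ht⟩ := (AddCircle.homeomorphCircle Real.two_pi_pos.ne').surjective
      (⟨z / r, mem_sphere_zero_iff_norm.2 hw⟩ : Circle)
    refine ⟨t, ?_⟩
    rw [← AddCircle.homeomorphCircle_apply Real.two_pi_pos.ne', ht]
    exact mul_div_cancel₀ _ (Complex.ofReal_ne_zero.2 hr.ne')
  have h1 : ‖p t - g t‖ < δ := by
    rw [← ContinuousMap.sub_apply]
    refine ((p - g).norm_coe_le_norm t).trans_lt ?_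
    rwa [← dist_eq_norm, dist_comm]
  refine lt_of_le_of_lt ?_ h1
  refine le_trans (le_of_eq ?_) (Complex.abs_re_le_norm (p t - g t))
  rw [h t, ht]
  simp [g, ht]

theorem lintegral_ball_zero_eq_lintegral_circleLIntegral {G : ℂ → ENNReal} (hG : Measurable G)
    (R : ℝ) :
    ∫⁻ z in Metric.ball 0 R, G z
      = ∫⁻ s in Set.Ioo 0 R, ENNReal.ofReal s * circleLIntegral G 0 s := by
  set F : ℂ → ENNReal := (Metric.ball 0 R).indicator G
  have hF : Measurable F := hG.indicator Metric.isOpen_ball.measurableSet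
  have hcirc : ∀ s : ℝ, ∫⁻ θ in Set.Ioo (-Real.pi) Real.pi, F (-(Complex.polarCoord.symm (s, θ)))
      = circleLIntegral F 0 s := by
    intro s
    have h1 := (measurePreserving_add_right volume Real.pi).setLIntegral_comp_preimage
      (measurableSet_Ioo (a := (0 : ℝ)) (b := 2 * Real.pi))
      (f := fun θ => F (circleMap 0 s θ)) (hF.comp (continuous_circleMap 0 s).measurable)
    rw [circleLIntegral, setLIntegral_congr Ioo_ae_eq_Ioc.symm, ← h1, Set.preimage_add_const_Ioo,
      show 0 - Real.pi = -Real.pi by ring, show 2 * Real.pi - Real.pi = Real.pi by ring]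
    refine lintegral_congr fun θ => ?_
    congr 1
    rw [Complex.polarCoord_symm_apply, circleMap, Complex.ofReal_add, add_mul, Complex.exp_add,
      Complex.exp_pi_mul_I, Complex.exp_mul_I]
    push_cast
    ring
  have hm : Measurable fun p : ℝ × ℝ =>
      ENNReal.ofReal p.1 • F (-(Complex.polarCoord.symm p)) := by
    refine (measurable_fst.ennreal_ofReal).smul (hF.comp ?_)
    simp only [Complex.polarCoord_symm_apply]
    fun_prop
  calc ∫⁻ z in Metric.ball 0 R, G z = ∫⁻ z, F z :=
        (lintegral_indicator Metric.isOpen_ball.measurableSet _).symm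
    _ = ∫⁻ z, F (-z) := (lintegral_neg_eq_self F).symm
    _ = ∫⁻ p in Set.Ioi (0 : ℝ) ×ˢ Set.Ioo (-Real.pi) Real.pi,
          ENNReal.ofReal p.1 • F (-(Complex.polarCoord.symm p)) := by
        rw [← Complex.lintegral_comp_polarCoord_symm (fun z => F (-z)), polarCoord_target]
    _ = ∫⁻ s in Set.Ioi 0, ENNReal.ofReal s * circleLIntegral F 0 s := by
        rw [Measure.volume_eq_prod, setLIntegral_prod _ hm.aemeasurable]
        refine lintegral_congr fun s => ?_
        rw [← hcirc, ← lintegral_const_mul']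
        · rfl
        · exact ENNReal.ofReal_ne_top
    _ = ∫⁻ s in Set.Ioi 0, (Set.Iio R).indicator
          (fun s => ENNReal.ofReal s * circleLIntegral G 0 s) s := by
        refine setLIntegral_congr_fun measurableSet_Ioi fun s hs => ?_
        have hn : ∀ θ, circleMap 0 s θ ∈ Metric.ball (0 : ℂ) R ↔ s < R := fun θ => by
          rw [mem_ball_zero_iff, norm_circleMap_zero, abs_of_pos hs]
        by_cases h : s < R
        · rw [Set.indicator_of_mem (Set.mem_Iio.2 h)]
          congr 1
          exact lintegral_congr fun θ => Set.indicator_of_mem ((hn θ).2 h) _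
        · rw [Set.indicator_of_notMem (Set.notMem_Iio.2 (not_lt.1 h)), circleLIntegral]
          simp [F, Set.indicator_of_notMem (fun h' => h ((hn _).1 h'))]
    _ = _ := by
        rw [lintegral_indicator measurableSet_Iio, Measure.restrict_restrict measurableSet_Iio,
          Set.inter_comm, Set.Ioi_inter_Iio]

theorem IsSuperMean.lintegral_unitDisk_lt_top {W : ℂ → ENNReal} {κ : ENNReal}
    (hS : IsSuperMean W κ) (hW : Measurable W) (h0 : W 0 ≠ ⊤) : ∫⁻ z in unitDisk, W z < ⊤ := by
  rw [unitDisk, lintegral_ball_zero_eq_lintegral_circleLIntegral hW]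
  refine lt_of_le_of_lt (setLIntegral_mono' measurableSet_Ioo (g := fun _ =>
    ENNReal.ofReal (2 * Real.pi) * W 0) fun s hs => ?_) ?_
  · have h1 : ENNReal.ofReal s ≤ 1 := by
      rw [← ENNReal.ofReal_one]
      exact ENNReal.ofReal_le_ofReal hs.2.le
    calc _ ≤ 1 * circleLIntegral W 0 s := mul_le_mul_left h1 _
      _ ≤ _ := by
        rw [one_mul]
        exact le_self_add.trans (hS 0 s hs.1 (closedBall_zero_subset_unitDisk hs.2))
  · rw [setLIntegral_const, Real.volume_Ioo]
    exact ENNReal.mul_lt_top (ENNReal.mul_lt_top ENNReal.ofReal_lt_top h0.lt_top)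
      ENNReal.ofReal_lt_top

theorem ofReal_re_mul_le_lintegral_ball {G : ℂ → ENNReal} (hG : Measurable G) {Q : ℂ → ℂ}
    (hQ : DifferentiableOn ℂ Q unitDisk) {R : ℝ} (hR : R < 1)
    (hle : ∀ z ∈ Metric.ball (0 : ℂ) R, ENNReal.ofReal (Q z).re ≤ G z) :
    ENNReal.ofReal (2 * Real.pi * (Q 0).re) * (∫⁻ s in Set.Ioo 0 R, ENNReal.ofReal s)
      ≤ ∫⁻ z in Metric.ball 0 R, G z := by
  rw [lintegral_ball_zero_eq_lintegral_circleLIntegral hG, ← lintegral_const_mul' _ _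
    ENNReal.ofReal_ne_top]
  refine setLIntegral_mono' measurableSet_Ioo fun s hs => ?_
  rw [mul_comm]
  refine mul_le_mul_right (ofReal_re_le_circleLIntegral hQ ?_ fun x hx => hle x ?_) _
  · rw [abs_of_pos hs.1]
    exact closedBall_zero_subset_unitDisk (hs.2.trans hR)
  · rw [abs_of_pos hs.1, mem_sphere_zero_iff_norm] at hx
    rw [mem_ball_zero_iff, hx]
    exact hs.2

theorem lintegral_Ioo_ofReal_ne_zero {R : ℝ} (hR : 0 < R) :
    ∫⁻ s in Set.Ioo 0 R, ENNReal.ofReal s ≠ 0 := by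
  refine ((setLIntegral_pos_iff measurable_id.ennreal_ofReal).2 ?_).ne'
  have : Function.support (fun s : ℝ => ENNReal.ofReal s) ∩ Set.Ioo 0 R = Set.Ioo 0 R := by
    refine Set.inter_eq_right.2 fun s hs => ?_
    simpa using hs.1
  change 0 < volume (Function.support (fun s : ℝ => ENNReal.ofReal s) ∩ Set.Ioo 0 R)
  rw [this, Real.volume_Ioo]
  simpa using hR

/-- A barrier on the punctured disk, vanishing on the unit circle. -/
def diskBarrier (z : ℂ) : ℝ := ‖z⁻¹‖ ^ 2 + ‖z‖ ^ 2 / 2 - 3 / 2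

theorem diskBarrier_eq {z : ℂ} (hz : z ≠ 0) :
    diskBarrier z = (1 - ‖z‖ ^ 2) * ((‖z‖ ^ 2)⁻¹ - 1 / 2) := by
  have : ‖z‖ ≠ 0 := norm_ne_zero_iff.2 hz
  rw [diskBarrier, norm_inv]
  field_simp
  ring

theorem exists_diskBarrier_minorant {z : ℂ} {ρ : ℝ} :
    ∃ Q : ℂ → ℂ, DifferentiableOn ℂ Q {0}ᶜ ∧
      (∀ x ∈ Metric.sphere z ρ, (Q x).re ≤ diskBarrier x) ∧
      (Q z).re = diskBarrier z + ρ ^ 2 / 2 := by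
  have hsub : ∀ a b : ℂ, ‖a - b‖ ^ 2 = ‖a‖ ^ 2 - 2 * (star b * a).re + ‖b‖ ^ 2 := by
    intro a b
    simp only [← Complex.normSq_eq_norm_sq, Complex.normSq_apply, Complex.star_def,
      Complex.mul_re, Complex.conj_re, Complex.conj_im, Complex.sub_re, Complex.sub_im]
    ring
  have hss : ∀ u : ℂ, (star u * u).re = ‖u‖ ^ 2 := by
    intro u
    rw [← Complex.normSq_eq_norm_sq, Complex.normSq_apply]
    simp [Complex.mul_re]
  refine ⟨fun x => ((2 : ℝ) : ℂ) * (star z⁻¹ * x⁻¹) + star z * x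
    + ((ρ ^ 2 / 2 - ‖z‖ ^ 2 / 2 - ‖z⁻¹‖ ^ 2 - 3 / 2 : ℝ) : ℂ), ?_, ?_, ?_⟩
  · have : DifferentiableOn ℂ (fun x : ℂ => x⁻¹) {0}ᶜ := differentiableOn_inv
    fun_prop
  · intro x hx
    have hxρ : ‖x - z‖ = ρ := by rwa [← dist_eq_norm]
    have h1 := hsub x z
    have h2 := hsub x⁻¹ z⁻¹
    rw [hxρ] at h1
    simp only [diskBarrier, Complex.add_re, Complex.re_ofReal_mul, Complex.ofReal_re]
    nlinarith [sq_nonneg ‖x⁻¹ - z⁻¹‖]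
  · simp only [diskBarrier, Complex.add_re, Complex.re_ofReal_mul, Complex.ofReal_re, hss]
    ring

/-- The weight `ω + (1 - |z|²)`, extended by zero outside the disk. -/
def diskWeight (ω : ℂ → ℝ) : ℂ → ENNReal :=
  unitDisk.indicator fun z => ENNReal.ofReal (ω z) + ENNReal.ofReal (1 - ‖z‖ ^ 2)

namespace SuperharmonicOn

variable {ω : ℂ → ℝ}

theorem circleLIntegral_ofReal_le (hω : SuperharmonicOn ω) {z : ℂ} {ρ : ℝ} (hρ : 0 < ρ)
    (hz : Metric.closedBall z ρ ⊆ unitDisk) :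
    circleLIntegral (fun x => ENNReal.ofReal (ω x)) z ρ ≤ ENNReal.ofReal (2 * Real.pi * ω z) :=
  hω.2 z ρ hρ hz

/-- A positive superharmonic function on the disk dominates a multiple of `1 - |z|²`. -/
theorem exists_mul_le (hωpos : ∀ z ∈ unitDisk, 0 < ω z) (hω : SuperharmonicOn ω) :
    ∃ c > 0, ∀ z ∈ unitDisk, c * (1 - ‖z‖ ^ 2) ≤ ω z := by
  have hhalf : Metric.closedBall (0 : ℂ) (1 / 2) ⊆ unitDisk :=
    closedBall_zero_subset_unitDisk (by norm_num)
  obtain ⟨y, hy, hmin⟩ := (hω.1.mono hhalf).exists_isMinOn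
    ⟨0, Metric.mem_closedBall_self (by norm_num)⟩ (isCompact_closedBall _ _)
  set m := ω y
  have hm : 0 < m := hωpos y (hhalf hy)
  have hin : ∀ z : ℂ, ‖z‖ ≤ 1 / 2 → m ≤ ω z := fun z hz => hmin (by simpa using hz)
  refine ⟨m / 6, by positivity, fun z hz => ?_⟩
  rcases le_or_gt ‖z‖ (1 / 2) with hz2 | hz2
  · nlinarith [hin z hz2, sq_nonneg ‖z‖]
  have hz1 := mem_unitDisk.1 hz
  have hz0 : z ≠ 0 := norm_pos_iff.1 (by linarith)
  set v : ℂ → ℝ := fun x => ω x - m / 3 * diskBarrier x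
  suffices hv : 0 ≤ v z by
    have h1 : (1 - ‖z‖ ^ 2) * (1 / 2) ≤ diskBarrier z := by
      rw [diskBarrier_eq hz0]
      have h2 : 1 ≤ (‖z‖ ^ 2)⁻¹ := (one_le_inv₀ (by positivity)).2 (by nlinarith)
      exact mul_le_mul_of_nonneg_left (by linarith) (by nlinarith)
    have h2 : 0 ≤ ω z - m / 3 * diskBarrier z := hv
    nlinarith
  by_contra! hneg
  obtain ⟨R, ⟨hRb, hzR⟩, hR1⟩ : ∃ R : ℝ, (m / 3 * (4 * (1 - R ^ 2)) < -v z ∧ ‖z‖ < R) ∧ R < 1 := by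
    have ht : Filter.Tendsto (fun R : ℝ => m / 3 * (4 * (1 - R ^ 2))) (nhds 1) (nhds 0) := by
      have : Continuous fun R : ℝ => m / 3 * (4 * (1 - R ^ 2)) := by fun_prop
      simpa using this.tendsto 1
    have h1 := (ht.eventually_lt_const (neg_pos.2 hneg)).and (lt_mem_nhds hz1)
    exact ((h1.filter_mono nhdsWithin_le_nhds).and self_mem_nhdsWithin).exists
      (f := nhdsWithin 1 (Set.Iio 1))
  set A : Set ℂ := Metric.closedBall 0 R ∩ (Metric.ball 0 (1 / 2))ᶜ
  have hA : IsCompact A := (isCompact_closedBall _ _).inter_right Metric.isOpen_ball.isClosed_compl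
  have hA0 : ∀ x ∈ A, 1 / 2 ≤ ‖x‖ ∧ ‖x‖ ≤ R := fun x hx =>
    ⟨by simpa using hx.2, by simpa using hx.1⟩
  have hAD : A ⊆ unitDisk := Set.inter_subset_left.trans (closedBall_zero_subset_unitDisk hR1)
  have hbc : ContinuousOn diskBarrier {0}ᶜ := by
    have : ContinuousOn (fun x : ℂ => x⁻¹) {0}ᶜ := continuousOn_inv₀
    unfold diskBarrier
    fun_prop
  have hA0' : A ⊆ {0}ᶜ := fun x hx h => by
    have := (hA0 x hx).1
    rw [Set.mem_singleton_iff.1 h, norm_zero] at this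
    linarith
  have hvl : LowerSemicontinuousOn v A := by
    have h1 : ContinuousOn (fun x => -(m / 3 * diskBarrier x)) A :=
      (continuousOn_const.mul (hbc.mono hA0')).neg
    have h2 := (hω.1.mono hAD).add h1.lowerSemicontinuousOn
    simpa only [← sub_eq_add_neg] using h2
  have hzA : z ∈ A := ⟨by simpa using hzR.le, by simpa using hz2.le⟩
  obtain ⟨w, hwA, hw⟩ := hvl.exists_isMinOn ⟨z, hzA⟩ hA
  have hvw : v w ≤ v z := hw hzA
  obtain ⟨hw1, hw2⟩ := hA0 w hwA
  have hw0 : w ≠ 0 := hA0' hwA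
  have hinv : (‖w‖ ^ 2)⁻¹ ≤ 4 := by
    rw [inv_le_comm₀ (by positivity) (by norm_num)]
    nlinarith
  have hbw : diskBarrier w ≤ (1 - ‖w‖ ^ 2) * 4 := by
    rw [diskBarrier_eq hw0]
    exact mul_le_mul_of_nonneg_left (by linarith) (by nlinarith)
  have hwlt1 : 1 / 2 < ‖w‖ := by
    refine lt_of_le_of_ne hw1 fun h => ?_
    have h1 : ω w - m / 3 * diskBarrier w < 0 := lt_of_le_of_lt hvw hneg
    rw [← h] at hbw
    nlinarith [hin w h.ge]
  have hwlt2 : ‖w‖ < R := by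
    refine lt_of_le_of_ne hw2 fun h => ?_
    have h1 : ω w - m / 3 * diskBarrier w ≤ v z := hvw
    rw [h] at hbw
    nlinarith [hωpos w (hAD hwA)]
  obtain ⟨ρ, hρ, hρA⟩ : ∃ ρ > 0, Metric.closedBall w ρ ⊆ A := by
    have : Metric.ball (0 : ℂ) R ∩ (Metric.closedBall 0 (1 / 2))ᶜ ∈ nhds w :=
      (Metric.isOpen_ball.inter Metric.isClosed_closedBall.isOpen_compl).mem_nhds
        ⟨by simpa using hwlt2, by simpa using hwlt1⟩
    obtain ⟨ρ, hρ, h⟩ := Metric.nhds_basis_closedBall.mem_iff.1 this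
    exact ⟨ρ, hρ, h.trans (Set.inter_subset_inter Metric.ball_subset_closedBall
      (Set.compl_subset_compl.2 Metric.ball_subset_closedBall))⟩
  obtain ⟨Q, hQ, hQs, hQw⟩ := exists_diskBarrier_minorant (z := w) (ρ := ρ)
  have h1 : ENNReal.ofReal (2 * Real.pi * ((v w : ℂ) + ((m / 3 : ℝ) : ℂ) * Q w).re)
      ≤ circleLIntegral (fun x => ENNReal.ofReal (ω x)) w ρ := by
    refine ofReal_re_le_circleLIntegral (Q := fun x => (v w : ℂ) + ((m / 3 : ℝ) : ℂ) * Q x)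
      ((hQ.const_mul _).const_add _) ?_ ?_
    · rw [abs_of_pos hρ]
      exact hρA.trans hA0'
    · rw [abs_of_pos hρ]
      intro x hx
      refine ENNReal.ofReal_le_ofReal ?_
      rw [Complex.add_re, Complex.ofReal_re, Complex.re_ofReal_mul]
      have h2 : v w ≤ ω x - m / 3 * diskBarrier x := hw (hρA (Metric.sphere_subset_closedBall hx))
      nlinarith [hQs x hx]
  have h2 := h1.trans (hω.circleLIntegral_ofReal_le hρ (hρA.trans hAD))
  have hωw := hωpos w (hAD hwA)
  rw [ENNReal.ofReal_le_ofReal_iff (by positivity), mul_le_mul_iff_right₀ Real.two_pi_pos,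
    Complex.add_re, Complex.ofReal_re, Complex.re_ofReal_mul, hQw] at h2
  have h3 : v w = ω w - m / 3 * diskBarrier w := rfl
  nlinarith [mul_pos hm (pow_pos hρ 2)]

theorem measurable_diskWeight (hω : SuperharmonicOn ω) : Measurable (diskWeight ω) := by
  have h0 : Measurable (unitDisk.indicator ω) := by
    refine measurable_of_Ioi fun a => ?_
    obtain ⟨u, hu, h⟩ := lowerSemicontinuousOn_iff_preimage_Ioi.1 hω.1 a
    rw [Set.indicator_preimage, Set.ite, Set.inter_comm, h]
    refine (measurableSet_unitDisk.inter hu.measurableSet).union ?_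
    exact (measurable_const measurableSet_Ioi).diff measurableSet_unitDisk
  have h1 : Measurable (unitDisk.indicator fun z => ENNReal.ofReal (ω z)) := by
    convert h0.ennreal_ofReal using 1
    ext z
    by_cases hz : z ∈ unitDisk <;> simp [hz]
  have h2 : Measurable (unitDisk.indicator fun z : ℂ => ENNReal.ofReal (1 - ‖z‖ ^ 2)) :=
    (by fun_prop : Measurable fun z : ℂ => ENNReal.ofReal (1 - ‖z‖ ^ 2)).indicator
      measurableSet_unitDisk
  have h3 : diskWeight ω = unitDisk.indicator (fun z => ENNReal.ofReal (ω z))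
      + unitDisk.indicator fun z : ℂ => ENNReal.ofReal (1 - ‖z‖ ^ 2) :=
    Set.indicator_add _ _ _
  rw [h3]
  exact h1.add h2

theorem isSuperMean_diskWeight (hωpos : ∀ z ∈ unitDisk, 0 < ω z) (hω : SuperharmonicOn ω) :
    IsSuperMean (diskWeight ω) 1 := by
  intro z ρ hρ hz
  have hcirc : ∀ θ, circleMap z ρ θ ∈ Metric.sphere z ρ := fun θ => circleMap_mem_sphere z hρ.le θ
  have hzD : z ∈ unitDisk := hz (Metric.mem_closedBall_self hρ.le)
  set Q : ℂ → ℂ := fun x => ((1 - ‖z‖ ^ 2 - ρ ^ 2 : ℝ) : ℂ) - ((2 : ℝ) : ℂ) * (star z * (x - z))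
  have hQ : DifferentiableOn ℂ Q Set.univ := by
    simp only [Q]
    fun_prop
  have hQre : ∀ θ, (Q (circleMap z ρ θ)).re = 1 - ‖circleMap z ρ θ‖ ^ 2 := by
    intro θ
    set x := circleMap z ρ θ
    have hxρ : ‖x - z‖ = ρ := by
      rw [← dist_eq_norm]
      exact hcirc θ
    have h4 : ‖x - z‖ ^ 2 = ‖x‖ ^ 2 - 2 * (star z * (x - z)).re - ‖z‖ ^ 2 := by
      simp only [← Complex.normSq_eq_norm_sq, Complex.normSq_apply, Complex.star_def,
        Complex.mul_re, Complex.conj_re, Complex.conj_im, Complex.sub_re, Complex.sub_im]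
      ring
    rw [hxρ] at h4
    simp only [Q, Complex.sub_re (_ : ℂ) (((2 : ℝ) : ℂ) * _), Complex.ofReal_re,
      Complex.re_ofReal_mul]
    linarith
  have hpos : ∀ θ, 0 ≤ 1 - ‖circleMap z ρ θ‖ ^ 2 := fun θ => by
    have := mem_unitDisk.1 (hz (Metric.sphere_subset_closedBall (hcirc θ)))
    nlinarith [norm_nonneg (circleMap z ρ θ)]
  obtain ⟨hint, hre⟩ := integrable_re_circleMap_and_integral_eq hQ (z := z) (ρ := ρ)
    (Set.subset_univ _)
  simp only [hQre] at hint hre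
  have hQz : (Q z).re = 1 - ‖z‖ ^ 2 - ρ ^ 2 := by
    simp only [Q, sub_self, mul_zero, sub_zero, Complex.ofReal_re]
  have h1 : ∫⁻ θ in Set.Ioc (0 : ℝ) (2 * Real.pi), ENNReal.ofReal (1 - ‖circleMap z ρ θ‖ ^ 2)
      = ENNReal.ofReal (2 * Real.pi * (1 - ‖z‖ ^ 2 - ρ ^ 2)) := by
    rw [← hQz, ← hre, ofReal_integral_eq_lintegral_ofReal hint (.of_forall hpos)]
  have h2 : circleLIntegral (diskWeight ω) z ρ
      = circleLIntegral (fun x => ENNReal.ofReal (ω x)) z ρ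
        + ENNReal.ofReal (2 * Real.pi * (1 - ‖z‖ ^ 2 - ρ ^ 2)) := by
    rw [← h1, circleLIntegral, circleLIntegral, ← lintegral_add_right]
    · refine lintegral_congr fun θ => ?_
      exact Set.indicator_of_mem (hz (Metric.sphere_subset_closedBall (hcirc θ))) _
    · exact ((continuous_const.sub ((continuous_circleMap z ρ).norm.pow 2)).measurable).ennreal_ofReal
  have hQz0 : 0 ≤ 2 * Real.pi * (1 - ‖z‖ ^ 2 - ρ ^ 2) := by
    rw [← hQz, ← hre]
    exact integral_nonneg hpos
  have hz1 : 0 ≤ 1 - ‖z‖ ^ 2 := by nlinarith [norm_nonneg z, mem_unitDisk.1 hzD]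
  rw [h2, one_mul, add_assoc, ← ENNReal.ofReal_add hQz0 (by positivity), diskWeight,
    Set.indicator_of_mem hzD, ← ENNReal.ofReal_add (hωpos z hzD).le hz1,
    ← ENNReal.ofReal_mul (by positivity), mul_add, ENNReal.ofReal_add
      (mul_nonneg (by positivity) (hωpos z hzD).le) (mul_nonneg (by positivity) hz1)]
  refine add_le_add (hω.circleLIntegral_ofReal_le hρ hz) (ENNReal.ofReal_le_ofReal (le_of_eq ?_))
  ring

theorem isDirichlet_diskWeight_iff (hωpos : ∀ z ∈ unitDisk, 0 < ω z) (hω : SuperharmonicOn ω)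
    {F : ℂ → ℂ} : IsDirichlet (diskWeight ω) F ↔ DifferentiableOn ℂ F unitDisk ∧
      ∫⁻ z in unitDisk, ENNReal.ofReal (‖deriv F z‖ ^ 2 * ω z) < ⊤ := by
  obtain ⟨c, hc, hcω⟩ := exists_mul_le hωpos hω
  refine ⟨fun h => ⟨h.1, lt_of_le_of_lt ?_ h.2⟩, fun h => ⟨h.1, ?_⟩⟩
  · refine setLIntegral_mono' measurableSet_unitDisk fun z hz => ?_
    rw [diskWeight, Set.indicator_of_mem hz, ENNReal.ofReal_mul (sq_nonneg _), mul_comm]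
    exact mul_le_mul_left le_self_add _
  · refine lt_of_le_of_lt (b := ∫⁻ z in unitDisk, ENNReal.ofReal (1 + c⁻¹)
      * ENNReal.ofReal (‖deriv F z‖ ^ 2 * ω z)) ?_ ?_
    · refine setLIntegral_mono' measurableSet_unitDisk fun z hz => ?_
      have hz1 : 0 ≤ 1 - ‖z‖ ^ 2 := by nlinarith [norm_nonneg z, mem_unitDisk.1 hz]
      rw [diskWeight, Set.indicator_of_mem hz, ← ENNReal.ofReal_add (hωpos z hz).le hz1,
        ← ENNReal.ofReal_mul (add_nonneg (hωpos z hz).le hz1), ← ENNReal.ofReal_mul (by positivity)]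
      refine ENNReal.ofReal_le_ofReal ?_
      have h1 : 1 - ‖z‖ ^ 2 ≤ c⁻¹ * ω z := by
        rw [le_inv_mul_iff₀ hc]
        exact hcω z hz
      nlinarith [sq_nonneg ‖deriv F z‖]
    · rw [lintegral_const_mul' _ _ ENNReal.ofReal_ne_top]
      exact ENNReal.mul_lt_top ENNReal.ofReal_lt_top h.2

theorem diskWeight_zero_ne_top : diskWeight ω 0 ≠ ⊤ := by
  rw [diskWeight, Set.indicator_of_mem (mem_unitDisk.2 (by simp))]
  exact ENNReal.add_ne_top.2 ⟨ENNReal.ofReal_ne_top, ENNReal.ofReal_ne_top⟩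

end SuperharmonicOn

/-- The minimum principle for the real part of a holomorphic function on a disk. -/
theorem re_nonneg_of_forall_mem_sphere {P : ℂ → ℂ} (hP : DifferentiableOn ℂ P unitDisk) {r : ℝ}
    (hr0 : 0 < r) (hr : r < 1) (h : ∀ z ∈ Metric.sphere (0 : ℂ) r, 0 ≤ (P z).re) {z : ℂ}
    (hz : z ∈ Metric.closedBall (0 : ℂ) r) : 0 ≤ (P z).re := by
  have hd : DiffContOnCl ℂ (fun z => Complex.exp (-P z)) (Metric.ball 0 r) := by
    refine DifferentiableOn.diffContOnCl ?_
    rw [closure_ball _ hr0.ne']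
    exact (hP.neg.cexp).mono (closedBall_zero_subset_unitDisk hr)
  have := Complex.norm_le_of_forall_mem_frontier_norm_le Metric.isBounded_ball hd (C := 1)
    (fun w hw => ?_) (z := z) (by rwa [closure_ball _ hr0.ne'])
  · simpa [Complex.norm_exp] using this
  · rw [frontier_ball _ hr0.ne'] at hw
    simpa [Complex.norm_exp] using h w hw

/-- A polynomial whose real part is slightly larger than `|Re f|` on a circle. -/
theorem exists_majorant_on_sphere {f : ℂ → ℂ} (hf : DifferentiableOn ℂ f unitDisk) {r β : ℝ}
    (hr0 : 0 < r) (hr : r < 1) (hβ : 0 < β) :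
    ∃ P : ℂ → ℂ, Differentiable ℂ P ∧ (P 0).im = 0 ∧ ∀ z ∈ Metric.sphere (0 : ℂ) r,
      |(f z).re| ≤ (P z).re ∧ (P z).re ≤ |(f z).re| + β ∧
        energyTest P f z < 2 * (1 - r ^ 2) := by
  have hc : ContinuousOn (fun z => |(f z).re|) (Metric.sphere 0 r) :=
    (Complex.continuous_re.comp_continuousOn (hf.continuousOn.mono
      (Metric.sphere_subset_closedBall.trans (closedBall_zero_subset_unitDisk hr)))).abs
  obtain ⟨M, hM⟩ := (isCompact_sphere (0 : ℂ) r).exists_bound_of_continuousOn hc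
  have hM' : ∀ z ∈ Metric.sphere (0 : ℂ) r, |(f z).re| ≤ |M| := fun z hz => by
    have := hM z hz
    rw [Real.norm_eq_abs, abs_abs] at this
    exact this.trans (le_abs_self M)
  have hr2 : 0 < 1 - r ^ 2 := by nlinarith
  set b := min β (min 1 ((1 - r ^ 2) / (2 * |M| + 2)))
  have hb : 0 < b := by positivity
  have hb1 : b ≤ 1 := (min_le_right _ _).trans (min_le_left _ _)
  have hb2 : b * (2 * |M| + 2) ≤ 1 - r ^ 2 :=
    (le_div_iff₀ (by positivity)).1 ((min_le_right _ _).trans (min_le_right _ _))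
  have hbβ : b ≤ β := min_le_left _ _
  obtain ⟨P, hP0, hP⟩ := exists_polynomial_re_near hr0 (hc.add (continuousOn_const (c := b / 2)))
    (half_pos hb)
  refine ⟨fun z => P.eval z, P.differentiable, hP0, fun z hz => ?_⟩
  have h1 := abs_lt.1 (hP z hz)
  rw [Pi.add_apply] at h1
  have h2 : |(f z).re| ≤ (P.eval z).re := by linarith
  have h3 : (P.eval z).re ≤ |(f z).re| + b := by linarith
  refine ⟨h2, h3.trans (by gcongr), ?_⟩
  have hzr : ‖z‖ = r := by simpa using hz
  have h4 : (P.eval z).re ^ 2 ≤ (|(f z).re| + b) ^ 2 :=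
    pow_le_pow_left₀ ((abs_nonneg _).trans h2) h3 2
  have h5 := hM' z hz
  have h6 := sq_abs (f z).re
  simp only [energyTest, hzr]
  nlinarith [mul_le_mul_of_nonneg_left h5 hb.le, mul_le_mul_of_nonneg_left hb1 hb.le]

/-- A uniform bound at the origin for the functions whose energy is controlled by that of `f`. -/
theorem IsSuperMean.exists_re_zero_le {W : ℂ → ENNReal} (hS : IsSuperMean W 1)
    (hW : Measurable W) (hWi : ∫⁻ z in unitDisk, W z < ⊤) {f : ℂ → ℂ}
    (hf : DifferentiableOn ℂ f unitDisk)
    (hC : ∫⁻ z in unitDisk, W z * ENNReal.ofReal (2 * ‖deriv f z‖ ^ 2 + 4) ≠ ⊤) :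
    ∃ K : ℝ, ∀ (H : ℂ → ℂ) (r ε : ℝ), Differentiable ℂ H → 1 / 2 ≤ r → r < 1 → ε ≤ 2 →
      (∀ z ∈ Metric.sphere (0 : ℂ) r, energyTest H f z < ε) → (H 0).re ≤ K := by
  set C := ∫⁻ z in unitDisk, W z * ENNReal.ofReal (2 * ‖deriv f z‖ ^ 2 + 4)
  have hc : ContinuousOn (fun z => (f z).re) (Metric.closedBall 0 (1 / 2)) :=
    Complex.continuous_re.comp_continuousOn (hf.continuousOn.mono
      (closedBall_zero_subset_unitDisk (by norm_num)))
  obtain ⟨M, hM⟩ := (isCompact_closedBall (0 : ℂ) (1 / 2)).exists_bound_of_continuousOn hc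
  set I := ∫⁻ s in Set.Ioo (0 : ℝ) (1 / 2), ENNReal.ofReal s with hI
  have hI0 : I ≠ 0 := lintegral_Ioo_ofReal_ne_zero (by norm_num)
  set V := ENNReal.ofReal (M ^ 2 + 3) * volume (Metric.ball (0 : ℂ) (1 / 2)) with hV
  have hV' : V ≠ ⊤ := ENNReal.mul_ne_top ENNReal.ofReal_ne_top measure_ball_lt_top.ne
  refine ⟨((C + V) / I).toReal / (2 * Real.pi), fun H r ε hH hr0 hr hε hbd => ?_⟩
  have hG : Measurable fun z => ENNReal.ofReal (H z).re :=
    (Complex.continuous_re.comp hH.continuous).measurable.ennreal_ofReal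
  have h1 := ofReal_re_mul_le_lintegral_ball hG hH.differentiableOn (R := 1 / 2) (by norm_num)
    fun z _ => le_rfl
  have hSm := measurableSet_energySet hH.differentiableOn hf (r := r) (ε := ε) hr
  have h2 : ∫⁻ z in Metric.ball (0 : ℂ) (1 / 2), ENNReal.ofReal (H z).re ≤ C + V := by
    calc ∫⁻ z in Metric.ball (0 : ℂ) (1 / 2), ENNReal.ofReal (H z).re
        ≤ ∫⁻ z in Metric.ball (0 : ℂ) (1 / 2), ((energySet H f r ε).indicator
            (fun z => ENNReal.ofReal (energyTest H f z - ε)) z + ENNReal.ofReal (M ^ 2 + 3)) := by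
          refine setLIntegral_mono' Metric.isOpen_ball.measurableSet fun z hz => ?_
          have hu : (f z).re ^ 2 ≤ M ^ 2 := by
            have := hM z (Metric.ball_subset_closedBall hz)
            rw [Real.norm_eq_abs] at this
            exact sq_le_sq' (abs_le.1 this).1 (abs_le.1 this).2
          have hz1 : ‖z‖ ^ 2 ≤ 1 := by
            have : ‖z‖ < 1 / 2 := by simpa using hz
            nlinarith [norm_nonneg z]
          have hle : (H z).re ≤ (energyTest H f z - ε) + (M ^ 2 + 3) := by
            unfold energyTest
            nlinarith [sq_nonneg ((H z).re - 1 / 2)]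
          by_cases hzS : z ∈ energySet H f r ε
          · rw [Set.indicator_of_mem hzS]
            exact (ENNReal.ofReal_le_ofReal hle).trans ENNReal.ofReal_add_le
          · rw [Set.indicator_of_notMem hzS, zero_add]
            have : energyTest H f z ≤ ε := by
              by_contra h
              exact hzS ⟨Metric.ball_subset_ball hr0 hz, not_le.1 h⟩
            exact ENNReal.ofReal_le_ofReal (by linarith)
      _ ≤ C + V := by
          rw [lintegral_add_right _ measurable_const, setLIntegral_const]
          gcongr
          calc _ ≤ ∫⁻ z, (energySet H f r ε).indicator
                  (fun z => ENNReal.ofReal (energyTest H f z - ε)) z := setLIntegral_le_lintegral _ _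
            _ = ∫⁻ z in energySet H f r ε, ENNReal.ofReal (energyTest H f z - ε) :=
                lintegral_indicator hSm _
            _ ≤ 2 * ∫⁻ z in energySet H f r ε, ENNReal.ofReal (energyTest H f z - ε) :=
                le_mul_of_one_le_left zero_le one_le_two
            _ ≤ C := le_add_self.trans
                (hS.energy_energySet_le hW hWi hH.differentiableOn hf hr hbd)
  have h3 : ENNReal.ofReal (2 * Real.pi * (H 0).re) ≤ (C + V) / I := by
    refine ENNReal.le_div_iff_mul_le (Or.inl hI0) (Or.inr ?_) |>.2 (h1.trans h2)
    exact ENNReal.add_ne_top.2 ⟨hC, hV'⟩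
  rw [le_div_iff₀ (by positivity), mul_comm]
  refine ENNReal.ofReal_le_iff_le_toReal ?_ |>.1 h3
  exact ENNReal.div_ne_top (ENNReal.add_ne_top.2 ⟨hC, hV'⟩) hI0

/-- Holomorphic functions with almost increasing real parts, bounded at the origin, converge. -/
theorem exists_tendstoLocallyUniformlyOn_of_re_le {P : ℕ → ℂ → ℂ} {r b : ℕ → ℝ} {K : ℝ}
    (hP : ∀ n, Differentiable ℂ (P n)) (him : ∀ n, (P n 0).im = 0) (hr0 : ∀ n, 0 < r n)
    (hr : Filter.Tendsto r Filter.atTop (nhds 1)) (hb : ∀ n, 0 < b n) (hbs : Summable b)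
    (hmono : ∀ n, ∀ z ∈ Metric.ball (0 : ℂ) (r n), (P n z).re ≤ (P (n + 1) z).re + b n)
    (hK : ∀ n, (P n 0).re ≤ K) :
    ∃ H : ℂ → ℂ, TendstoLocallyUniformlyOn P H Filter.atTop unitDisk := by
  have h0 : ∀ n, 0 ≤ (P (n + 1) 0).re - (P n 0).re + b n := fun n => by
    linarith [hmono n 0 (Metric.mem_ball_self (hr0 n))]
  have hsum : Summable fun n => (P (n + 1) 0).re - (P n 0).re + b n := by
    refine summable_of_sum_range_le (c := K - (P 0 0).re + ∑' n, b n) h0 fun n => ?_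
    rw [Finset.sum_add_distrib, Finset.sum_range_sub (fun n => (P n 0).re)]
    gcongr
    · exact hK n
    · exact hbs.sum_le_tsum _ fun i _ => (hb i).le
  have hD0 : ∀ n, ‖P (n + 1) 0 - P n 0 + b n‖ = (P (n + 1) 0).re - (P n 0).re + b n := fun n => by
    have : P (n + 1) 0 - P n 0 + b n = (((P (n + 1) 0).re - (P n 0).re + b n : ℝ) : ℂ) := by
      apply Complex.ext <;> simp [him]
    rw [this, Complex.norm_real, Real.norm_of_nonneg (h0 n)]
  refine ⟨fun z => P 0 z + ∑' n, (P (n + 1) z - P n z), ?_⟩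
  rw [tendstoLocallyUniformlyOn_iff_forall_isCompact isOpen_unitDisk]
  intro A hA hAc
  obtain ⟨s, hs1, hs⟩ : ∃ s < 1, ∀ z ∈ A, ‖z‖ ≤ s := by
    rcases A.eq_empty_or_nonempty with rfl | hne
    · exact ⟨0, by norm_num, by simp⟩
    · obtain ⟨y, hy, hmax⟩ := hAc.exists_isMaxOn hne continuous_norm.continuousOn
      exact ⟨‖y‖, mem_unitDisk.1 (hA hy), fun z hz => hmax hz⟩
  set R := (1 + s) / 2 with hR
  have hsR : s < R := by rw [hR]; linarith
  have hR1 : R < 1 := by rw [hR]; linarith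
  have hu : Summable fun n => (2 * b n + 2 * ((P (n + 1) 0).re - (P n 0).re + b n)) / (R - s)
      + b n := (((hbs.mul_left 2).add (hsum.mul_left 2)).div_const _).add hbs
  have key := tendstoUniformlyOn_tsum_nat_eventually (f := fun n z => P (n + 1) z - P n z)
    (s := A) hu ?_
  · rw [Metric.tendstoUniformlyOn_iff] at key ⊢
    intro ε hε
    filter_upwards [key ε hε] with n hn z hz
    have := hn z hz
    rwa [Finset.sum_range_sub (fun n => P n z), ← dist_add_left (P 0 z), add_sub_cancel] at this
  filter_upwards [hr.eventually (lt_mem_nhds hR1)] with n hn z hz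
  have hzs := hs z hz
  have hzb : z ∈ Metric.ball (0 : ℂ) R := by simpa using hzs.trans_lt hsR
  have hRpos : 0 < R := (norm_nonneg z).trans_lt (hzs.trans_lt hsR)
  have hbc := Complex.borelCaratheodory (f := fun z => -(P (n + 1) z - P n z + b n)) (hb n)
    ((((hP (n + 1)).sub (hP n)).add_const _).neg.differentiableOn) (fun w hw => by
      have := hmono n w (Metric.ball_subset_ball hn.le hw)
      simp only [Set.mem_ofPred_eq, Complex.neg_re, Complex.add_re, Complex.sub_re,
        Complex.ofReal_re]
      linarith [hb n]) hRpos hzb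
  rw [norm_neg, norm_neg, hD0, ← add_div] at hbc
  have h1 : ‖P (n + 1) z - P n z‖ ≤ ‖P (n + 1) z - P n z + b n‖ + b n := by
    have := norm_sub_le (P (n + 1) z - P n z + b n) (b n : ℂ)
    rwa [add_sub_cancel_right, Complex.norm_real, Real.norm_of_nonneg (hb n).le] at this
  refine h1.trans (add_le_add (hbc.trans ?_) le_rfl)
  have := hb n
  have h00 := h0 n
  have : 0 < R - s := by linarith
  gcongr ?_ / ?_
  · refine add_le_add (mul_le_of_le_one_right (by positivity) (by linarith)) ?_
    rw [mul_comm (2 : ℝ)]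
    exact mul_le_mul_of_nonneg_left (by linarith) h00
  · linarith

/-- In a weighted Dirichlet space, `|Re f|` is dominated by the real part of another member. -/
theorem IsSuperMean.exists_isDirichlet_abs_re_le {W : ℂ → ENNReal} (hS : IsSuperMean W 1)
    (hW : Measurable W) (hWi : ∫⁻ z in unitDisk, W z < ⊤) {f : ℂ → ℂ} (hf : IsDirichlet W f) :
    ∃ H : ℂ → ℂ, IsDirichlet W H ∧ ∀ z ∈ unitDisk, |(f z).re| ≤ (H z).re := by
  have hC : ∫⁻ z in unitDisk, W z * ENNReal.ofReal (2 * ‖deriv f z‖ ^ 2 + 4) ≠ ⊤ := by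
    have : ∀ z, W z * ENNReal.ofReal (2 * ‖deriv f z‖ ^ 2 + 4)
        = 2 * (W z * ENNReal.ofReal (‖deriv f z‖ ^ 2)) + 4 * W z := fun z => by
      rw [ENNReal.ofReal_add (by positivity) (by norm_num), ENNReal.ofReal_mul (by norm_num)]
      simp only [ENNReal.ofReal_ofNat]
      ring
    simp_rw [this]
    rw [lintegral_add_right _ (hW.const_mul _), lintegral_const_mul' _ _ (by simp),
      lintegral_const_mul' _ _ (by simp)]
    exact ENNReal.add_ne_top.2 ⟨ENNReal.mul_ne_top (by simp) hf.2.ne,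
      ENNReal.mul_ne_top (by simp) hWi.ne⟩
  obtain ⟨K, hK⟩ := hS.exists_re_zero_le hW hWi hf.1 hC
  set r : ℕ → ℝ := fun n => 1 - 1 / ((n : ℝ) + 2) with hrdef
  have hr : Filter.Tendsto r Filter.atTop (nhds 1) := by
    have h : Filter.Tendsto (fun n : ℕ => 1 / ((n : ℝ) + 2)) Filter.atTop (nhds 0) := by
      refine Filter.Tendsto.const_div_atTop ?_ 1
      exact Filter.tendsto_atTop_add_const_right _ _ tendsto_natCast_atTop_atTop
    simpa [hrdef] using h.const_sub 1
  have hrhalf : ∀ n, 1 / 2 ≤ r n := fun n => by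
    have : 1 / ((n : ℝ) + 2) ≤ 1 / 2 :=
      one_div_le_one_div_of_le (by norm_num) (by linarith [n.cast_nonneg (α := ℝ)])
    simp only [hrdef]
    linarith
  have hr0 : ∀ n, 0 < r n := fun n => by linarith [hrhalf n]
  have hr1 : ∀ n, r n < 1 := fun n => by
    have : 0 < 1 / ((n : ℝ) + 2) := by positivity
    simp only [hrdef]
    linarith
  have hβ : ∀ n : ℕ, (0 : ℝ) < (1 / 2) ^ n := fun n => by positivity
  choose P hP him hsph using fun n => exists_majorant_on_sphere hf.1 (hr0 n) (hr1 n) (hβ n)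
  have hmaj : ∀ n, ∀ z ∈ Metric.closedBall (0 : ℂ) (r n), |(f z).re| ≤ (P n z).re := by
    intro n z hz
    have h1 := re_nonneg_of_forall_mem_sphere ((hP n).differentiableOn.sub hf.1) (hr0 n) (hr1 n)
      (fun w hw => by
        simpa using (le_abs_self _).trans (hsph n w hw).1) hz
    have h2 := re_nonneg_of_forall_mem_sphere ((hP n).differentiableOn.add hf.1) (hr0 n) (hr1 n)
      (fun w hw => by
        have := (neg_abs_le _).trans' (neg_le_neg (hsph n w hw).1)
        simp only [Pi.add_apply, Complex.add_re]
        linarith) hz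
    simp only [Pi.sub_apply, Pi.add_apply, Complex.sub_re, Complex.add_re] at h1 h2
    exact abs_le.2 ⟨by linarith, by linarith⟩
  have hmono : Monotone r := monotone_nat_of_le_succ fun n => by
    simp only [hrdef, Nat.cast_add, Nat.cast_one]
    gcongr
    linarith
  have hstep : ∀ n, ∀ z ∈ Metric.ball (0 : ℂ) (r n),
      (P n z).re ≤ (P (n + 1) z).re + (1 / 2 : ℝ) ^ n := by
    intro n z hz
    have := re_nonneg_of_forall_mem_sphere
      (P := P (n + 1) - P n + fun _ => (((1 / 2 : ℝ) ^ n : ℝ) : ℂ))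
      (((hP (n + 1)).sub (hP n)).differentiableOn.add (differentiableOn_const _)) (hr0 n) (hr1 n)
      (fun w hw => by
        have h1 := hmaj (n + 1) w (Metric.closedBall_subset_closedBall (hmono n.le_succ)
          (Metric.sphere_subset_closedBall hw))
        have h2 := (hsph n w hw).2.1
        simp only [Pi.add_apply, Pi.sub_apply, Complex.add_re, Complex.sub_re, Complex.ofReal_re]
        linarith) (Metric.ball_subset_closedBall hz)
    simp only [Pi.add_apply, Pi.sub_apply, Complex.add_re, Complex.sub_re,
      Complex.ofReal_re] at this
    linarith
  obtain ⟨H, hH⟩ := exists_tendstoLocallyUniformlyOn_of_re_le hP him hr0 hr hβ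
    summable_geometric_two hstep fun n => hK (P n) (r n) (2 * (1 - r n ^ 2)) (hP n) (hrhalf n)
      (hr1 n) (by nlinarith [sq_nonneg (r n)]) fun z hz => (hsph n z hz).2.2
  have hev : ∀ z ∈ unitDisk, ∀ᶠ n in Filter.atTop, z ∈ Metric.ball (0 : ℂ) (r n) := fun z hz => by
    filter_upwards [hr.eventually (lt_mem_nhds (mem_unitDisk.1 hz))] with n hn
    simpa using hn
  have hHd : DifferentiableOn ℂ H unitDisk :=
    hH.differentiableOn (Filter.Eventually.of_forall fun n => (hP n).differentiableOn)
      isOpen_unitDisk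
  have hderiv := hH.deriv (Filter.Eventually.of_forall fun n => (hP n).differentiableOn)
    isOpen_unitDisk
  refine ⟨H, ⟨hHd, ?_⟩, fun z hz => ?_⟩
  · set S : ℕ → Set ℂ := fun n => energySet (P n) f (r n) (2 * (1 - r n ^ 2))
    have hSm : ∀ n, MeasurableSet (S n) := fun n =>
      measurableSet_energySet (hP n).differentiableOn hf.1 (hr1 n)
    set g : ℕ → ℂ → ENNReal := fun n =>
      (S n).indicator fun z => W z * ENNReal.ofReal (‖deriv (P n) z‖ ^ 2)
    have hgm : ∀ n, Measurable (g n) := fun n => by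
      refine (hW.mul ?_).indicator (hSm n)
      exact ((measurable_deriv _).norm.pow_const 2).ennreal_ofReal
    have hlim : ∀ z ∈ unitDisk, W z * ENNReal.ofReal (‖deriv H z‖ ^ 2)
        ≤ Filter.liminf (fun n => g n z) Filter.atTop := by
      intro z hz
      have h1 : ∀ᶠ n in Filter.atTop, z ∈ S n := by
        have h2 : Filter.Tendsto (fun n => 2 * (1 - r n ^ 2)) Filter.atTop (nhds 0) := by
          simpa using ((hr.pow 2).const_sub 1).const_mul 2
        have h3 : 0 < 1 - ‖z‖ ^ 2 := by
          have := mem_unitDisk.1 hz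
          nlinarith [norm_nonneg z]
        filter_upwards [hev z hz, h2.eventually (gt_mem_nhds h3)] with n hn hn'
        refine ⟨hn, hn'.trans_le ?_⟩
        have := pow_le_pow_left₀ (abs_nonneg _) (hmaj n z (Metric.ball_subset_closedBall hn)) 2
        rw [sq_abs] at this
        unfold energyTest
        linarith
      have h4 : Filter.Tendsto (fun n => ENNReal.ofReal (‖deriv (P n) z‖ ^ 2)) Filter.atTop
          (nhds (ENNReal.ofReal (‖deriv H z‖ ^ 2))) :=
        ENNReal.tendsto_ofReal ((hderiv.tendsto_at hz).norm.pow 2)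
      rcases eq_or_ne (ENNReal.ofReal (‖deriv H z‖ ^ 2)) 0 with h0 | h0
      · simp [h0]
      · refine ((ENNReal.Tendsto.const_mul h4 (Or.inl h0)).congr' ?_).liminf_eq.ge
        filter_upwards [h1] with n hn
        simp only [g, Set.indicator_of_mem hn]
    refine lt_of_le_of_lt ?_ hC.lt_top
    calc dirichletEnergy W H unitDisk
        ≤ ∫⁻ z in unitDisk, Filter.liminf (fun n => g n z) Filter.atTop :=
          setLIntegral_mono' measurableSet_unitDisk hlim
      _ ≤ Filter.liminf (fun n => ∫⁻ z in unitDisk, g n z) Filter.atTop := lintegral_liminf_le hgm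
      _ ≤ _ := by
          refine Filter.liminf_le_of_le (by isBoundedDefault) fun b hb => ?_
          obtain ⟨n, hn⟩ := hb.exists
          refine hn.trans ?_
          calc _ ≤ ∫⁻ z, g n z := setLIntegral_le_lintegral _ _
            _ = dirichletEnergy W (P n) (S n) := lintegral_indicator (hSm n) _
            _ ≤ _ := le_self_add.trans (hS.energy_energySet_le hW hWi (hP n).differentiableOn
                hf.1 (hr1 n) fun z hz => (hsph n z hz).2.2)
  · refine ge_of_tendsto ((Complex.continuous_re.tendsto _).comp (hH.tendsto_at hz)) ?_
    filter_upwards [hev z hz] with n hn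
    exact hmaj n z (Metric.ball_subset_closedBall hn)

/-- **Weighted composition operators on weighted Dirichlet spaces.** Let `ω` be a
positive superharmonic function on the unit disk.  A ℂ-linear map
`T : 𝒟_ω → hol(𝔻)` (not assumed continuous) such that `(Tg)(z) ≠ 0` for every
nowhere-vanishing `g ∈ 𝒟_ω` and every `z ∈ 𝔻` is a weighted composition operator:
`Tf = ψ · (f ∘ φ)` for holomorphic `φ : 𝔻 → 𝔻` and `ψ : 𝔻 → ℂ∖{0}`. -/
theorem dirichlet_weighted_composition (ω : ℂ → ℝ)
    (hωpos : ∀ z ∈ unitDisk, 0 < ω z) (hω : SuperharmonicOn ω)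
    (T : (unitDisk → ℂ) → (unitDisk → ℂ))
    (hThol : ∀ f : unitDisk → ℂ, dirichletMem ω f → HolOn (T f))
    (hadd : ∀ f g : unitDisk → ℂ, dirichletMem ω f → dirichletMem ω g →
      T (f + g) = T f + T g)
    (hsmul : ∀ (c : ℂ) (f : unitDisk → ℂ), dirichletMem ω f → T (c • f) = c • T f)
    (hne : ∀ g : unitDisk → ℂ, dirichletMem ω g → (∀ z : unitDisk, g z ≠ 0) →
      ∀ z : unitDisk, T g z ≠ 0) :
    ∃ (φ : unitDisk → unitDisk) (ψ : unitDisk → ℂ),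
      HolOn (fun z => (φ z : ℂ)) ∧ HolOn ψ ∧ (∀ z : unitDisk, ψ z ≠ 0) ∧
      ∀ f : unitDisk → ℂ, dirichletMem ω f → ∀ z : unitDisk, T f z = ψ z * f (φ z) := by
  have hS := hω.isSuperMean_diskWeight hωpos
  have hW := hω.measurable_diskWeight
  have hWi := hS.lintegral_unitDisk_lt_top hW SuperharmonicOn.diskWeight_zero_ne_top
  have hmem : ∀ F, IsDirichlet (diskWeight ω) F → dirichletMem ω (unitDisk.domRestrict F) :=
    fun F hF => by
      have h := (hω.isDirichlet_diskWeight_iff hωpos).1 hF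
      exact ⟨F, h.1, fun _ => rfl, h.2⟩
  have h1 : IsDirichlet (diskWeight ω) 1 := IsDirichlet.const 1
  have hid : IsDirichlet (diskWeight ω) fun z => z := IsDirichlet.id hWi
  have hψ : ∀ z, T (unitDisk.domRestrict (1 : ℂ → ℂ)) z ≠ 0 := hne _ (hmem _ h1) fun _ => one_ne_zero
  have hL : ∀ z, IsNonvanishingFunctional (diskWeight ω)
      fun F => T (unitDisk.domRestrict F) z / T (unitDisk.domRestrict (1 : ℂ → ℂ)) z := fun z =>
    { map_add := fun F G hF hG => by
        have : unitDisk.domRestrict (F + G) = unitDisk.domRestrict F + unitDisk.domRestrict G := rfl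
        simp only [this, hadd _ _ (hmem F hF) (hmem G hG), Pi.add_apply, add_div]
      map_smul := fun c F hF => by
        have : unitDisk.domRestrict (c • F) = c • unitDisk.domRestrict F := rfl
        simp only [this, hsmul c _ (hmem F hF), Pi.smul_apply, smul_eq_mul, mul_div_assoc]
      map_one := div_self (hψ z)
      ne_zero := fun F hF h0 => div_ne_zero (hne _ (hmem F hF) (fun w => h0 w w.2) z) (hψ z) }
  refine ⟨fun z => ⟨_, (hL z).map_mem_unitDisk hW hWi⟩, T (unitDisk.domRestrict (1 : ℂ → ℂ)), ?_,
    hThol _ (hmem _ h1), hψ, ?_⟩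
  · obtain ⟨A, hA, hTA⟩ := hThol _ (hmem _ hid)
    obtain ⟨B, hB, hTB⟩ := hThol _ (hmem _ h1)
    exact ⟨fun z => A z / B z, hA.div hB fun z hz => by rw [← hTB ⟨z, hz⟩]; exact hψ _,
      fun z => by simp only [hTA, hTB]⟩
  · rintro f ⟨F, hF, hfF, hE⟩ z
    have hFD : IsDirichlet (diskWeight ω) F :=
      (hω.isDirichlet_diskWeight_iff hωpos).2 ⟨hF, hE⟩
    have hfr : f = unitDisk.domRestrict F := funext hfF
    obtain ⟨H, hH, hFH⟩ := hS.exists_isDirichlet_abs_re_le hW hWi hFD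
    have := (hL z).map_eq hW hWi hFD hH hFH
    rw [div_eq_iff (hψ z), mul_comm] at this
    rw [hfr]
    exact this
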